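/- arXiv:2604.13703 — 9 statements merged into one kernel-verified Lean document; each statement's English description precedes it below -/
import Mathlib

section
/- Let Y(x) = e^{-|x|}/(4π|x|) be the Yukawa kernel on ℝ³ (the Green's function of the operator I − Δ_x). For every measurable f : ℝ³ → ℝ, every 0 < δ < 2 and every unit vector Ω ∈ S², one has ∫_{ℝ³} |(Y ∗ f)(x)|² e^{δ(x·Ω)} dx ≤ (32/(2−δ)⁴) ∫_{ℝ³} |f(y)|² e^{δ(y·Ω)} dy, where (Y ∗ f)(x) = ∫_{ℝ³} (1/(4π|x−y|)) e^{-|x−y|} f(y) dy. -/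
open MeasureTheory Real
open scoped ENNReal RealInnerProductSpace

noncomputable section

abbrev E3 : Type := EuclideanSpace ℝ (Fin 3)

/-- Convolution with the Yukawa kernel `Y(z) = e^{-|z|} / (4 π |z|)`. -/
def yukawaConv (f : E3 → ℝ) (x : E3) : ℝ :=
  ∫ y : E3, (1 / (4 * π * ‖x - y‖)) * Real.exp (-‖x - y‖) * f y

/-- Cauchy–Schwarz inequality with respect to a weight `w`. -/
theorem sq_lintegral_mul_le {α : Type*} [MeasurableSpace α] {μ : Measure α} {w g : α → ℝ≥0∞}
    (hw : Measurable w) (hg : Measurable g) :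
    (∫⁻ a, w a * g a ∂μ) ^ 2 ≤ (∫⁻ a, w a ∂μ) * ∫⁻ a, w a * g a ^ 2 ∂μ := by
  have hsq (t : ℝ≥0∞) : (t ^ (1 / 2 : ℝ)) ^ (2 : ℕ) = t := by
    rw [← ENNReal.rpow_natCast, ← ENNReal.rpow_mul]; norm_num
  have key := ENNReal.lintegral_mul_le_Lp_mul_Lq μ Real.HolderConjugate.two_two
    (f := fun a ↦ w a ^ (1 / 2 : ℝ)) (g := fun a ↦ w a ^ (1 / 2 : ℝ) * g a)
    (hw.pow_const _).aemeasurable ((hw.pow_const _).mul hg).aemeasurable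
  simp only [Pi.mul_apply, ENNReal.rpow_two, mul_pow, ← mul_assoc, ← sq, hsq] at key
  calc (∫⁻ a, w a * g a ∂μ) ^ 2
      ≤ ((∫⁻ a, w a ∂μ) ^ (1 / 2 : ℝ) * (∫⁻ a, w a * g a ^ 2 ∂μ) ^ (1 / 2 : ℝ)) ^ 2 := by
        gcongr
    _ = _ := by rw [mul_pow, hsq, hsq]

/-- Young's convolution inequality `L¹ ∗ L² ⊆ L²` for nonnegative functions. -/
theorem lintegral_sq_lintegral_sub_mul_le {G : Type*} [MeasurableSpace G] [AddCommGroup G]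
    [MeasurableAdd₂ G] [MeasurableNeg G] [MeasurableSub₂ G] {μ : Measure G} [SFinite μ]
    [μ.IsAddLeftInvariant] [μ.IsNegInvariant] {w g : G → ℝ≥0∞}
    (hw : Measurable w) (hg : Measurable g) :
    ∫⁻ x, (∫⁻ y, w (x - y) * g y ∂μ) ^ 2 ∂μ ≤ (∫⁻ z, w z ∂μ) ^ 2 * ∫⁻ y, g y ^ 2 ∂μ := by
  calc ∫⁻ x, (∫⁻ y, w (x - y) * g y ∂μ) ^ 2 ∂μ
      ≤ ∫⁻ x, (∫⁻ z, w z ∂μ) * ∫⁻ y, w (x - y) * g y ^ 2 ∂μ ∂μ := by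
        refine lintegral_mono fun x ↦ ?_
        refine (sq_lintegral_mul_le (hw.comp (measurable_const.sub measurable_id)) hg).trans_eq ?_
        congr 1
        exact lintegral_sub_left_eq_self w x
    _ = (∫⁻ z, w z ∂μ) * ∫⁻ y, ∫⁻ x, w (x - y) * g y ^ 2 ∂μ ∂μ := by
        have hm : Measurable fun p : G × G ↦ w (p.1 - p.2) * g p.2 ^ 2 :=
          (hw.comp measurable_sub).mul ((hg.comp measurable_snd).pow_const 2)
        rw [lintegral_const_mul _ hm.lintegral_prod_right',
          lintegral_lintegral_swap hm.aemeasurable]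
    _ = (∫⁻ z, w z ∂μ) ^ 2 * ∫⁻ y, g y ^ 2 ∂μ := by
        have (y : G) : ∫⁻ x, w (x - y) * g y ^ 2 ∂μ = (∫⁻ z, w z ∂μ) * g y ^ 2 := by
          rw [lintegral_mul_const _ (by fun_prop),
            lintegral_sub_right_eq_self w y]
        simp_rw [this]
        rw [lintegral_const_mul _ (hg.pow_const 2), sq, mul_assoc]

/-- The Yukawa kernel with decay rate `a`. -/
def yukawaKernel (a : ℝ) (z : E3) : ℝ := 1 / (4 * π * ‖z‖) * Real.exp (-(a * ‖z‖))

theorem measurable_yukawaKernel (a : ℝ) : Measurable (yukawaKernel a) := by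
  unfold yukawaKernel; fun_prop

theorem yukawaKernel_nonneg (a : ℝ) (z : E3) : 0 ≤ yukawaKernel a z := by
  unfold yukawaKernel; positivity

theorem integral_yukawaKernel {a : ℝ} (ha : 0 < a) : ∫ z, yukawaKernel a z = 1 / a ^ 2 := by
  have hball : (volume : Measure E3).real (Metric.ball 0 1) = π * 4 / 3 := by
    rw [Measure.real, EuclideanSpace.volume_ball_fin_three]
    simp [ENNReal.toReal_ofReal (by positivity : 0 ≤ π * 4 / 3)]
  have hradial : ∫ r in Set.Ioi (0 : ℝ), r ^ 2 • (1 / (4 * π * r) * Real.exp (-(a * r))) =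
      1 / (4 * π) * (1 / a ^ 2) := by
    have h := Real.integral_rpow_mul_exp_neg_mul_Ioi (a := 2) two_pos ha
    rw [Real.Gamma_two, mul_one, Real.rpow_two, one_div_pow] at h
    rw [← h, ← integral_const_mul]
    refine setIntegral_congr_fun measurableSet_Ioi fun r (hr : 0 < r) ↦ ?_
    norm_num
    field_simp
  have h := integral_fun_norm_addHaar (volume : Measure E3)
    fun r ↦ 1 / (4 * π * r) * Real.exp (-(a * r))
  rw [finrank_euclideanSpace_fin, hball, hradial] at h
  unfold yukawaKernel
  rw [h, nsmul_eq_mul, smul_eq_mul]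
  push_cast
  field_simp

theorem lintegral_yukawaKernel {a : ℝ} (ha : 0 < a) :
    ∫⁻ z, ENNReal.ofReal (yukawaKernel a z) = ENNReal.ofReal (1 / a ^ 2) := by
  have hint : Integrable (yukawaKernel a) :=
    .of_integral_ne_zero (by rw [integral_yukawaKernel ha]; positivity)
  rw [← integral_yukawaKernel ha,
    ofReal_integral_eq_lintegral_ofReal hint (.of_forall (yukawaKernel_nonneg a))]

/-- The exponential weight `e^{b (x·Ω)}` can be moved under the convolution at the price of a
slower decay of the kernel. -/
theorem enorm_yukawaConv_mul_exp_le (f : E3 → ℝ) {b : ℝ} (hb : 0 ≤ b) {Ω : E3} (hΩ : ‖Ω‖ = 1)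
    (x : E3) :
    ‖yukawaConv f x * Real.exp (b * ⟪x, Ω⟫)‖ₑ ≤
      ∫⁻ y, ENNReal.ofReal (yukawaKernel (1 - b) (x - y)) * ‖f y * Real.exp (b * ⟪y, Ω⟫)‖ₑ := by
  rw [yukawaConv, ← integral_mul_const]
  refine (enorm_integral_le_lintegral_enorm _).trans (lintegral_mono fun y ↦ ?_)
  have hinner : ⟪x, Ω⟫ ≤ ‖x - y‖ + ⟪y, Ω⟫ := by
    have h := real_inner_le_norm (x - y) Ω
    rw [inner_sub_left, hΩ, mul_one] at h
    linarith
  have hexp : Real.exp (-‖x - y‖) * Real.exp (b * ⟪x, Ω⟫) ≤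
      Real.exp (-((1 - b) * ‖x - y‖)) * Real.exp (b * ⟪y, Ω⟫) := by
    rw [← Real.exp_add, ← Real.exp_add, Real.exp_le_exp]
    nlinarith
  rw [← Real.enorm_of_nonneg (yukawaKernel_nonneg _ _), ← enorm_mul, enorm_le_iff_norm_le]
  simp only [norm_mul, Real.norm_eq_abs, Real.abs_exp, abs_of_nonneg (yukawaKernel_nonneg _ _)]
  rw [abs_of_nonneg (by positivity : 0 ≤ 1 / (4 * π * ‖x - y‖)), yukawaKernel]
  calc 1 / (4 * π * ‖x - y‖) * Real.exp (-‖x - y‖) * |f y| * Real.exp (b * ⟪x, Ω⟫)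
      = 1 / (4 * π * ‖x - y‖) * |f y| *
          (Real.exp (-‖x - y‖) * Real.exp (b * ⟪x, Ω⟫)) := by ring
    _ ≤ 1 / (4 * π * ‖x - y‖) * |f y| *
          (Real.exp (-((1 - b) * ‖x - y‖)) * Real.exp (b * ⟪y, Ω⟫)) := by gcongr
    _ = _ := by ring

/-- Weighted `L²` bound for the Yukawa potential `(I - Δ)⁻¹`:
`∫ |(Y ∗ f)(x)|² e^{δ (x·Ω)} dx ≤ 32/(2-δ)⁴ ∫ |f(y)|² e^{δ (y·Ω)} dy`. -/
theorem yukawa_weighted_L2_bound (f : E3 → ℝ) (hf : Measurable f)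
    (δ : ℝ) (hδ0 : 0 < δ) (hδ2 : δ < 2) (Ω : E3) (hΩ : ‖Ω‖ = 1) :
    ∫⁻ x : E3, ENNReal.ofReal ((yukawaConv f x) ^ 2 * Real.exp (δ * ⟪x, Ω⟫)) ≤
      ENNReal.ofReal (32 / (2 - δ) ^ 4) *
        ∫⁻ y : E3, ENNReal.ofReal ((f y) ^ 2 * Real.exp (δ * ⟪y, Ω⟫)) := by
  have hweight (u : ℝ) (x : E3) : ENNReal.ofReal (u ^ 2 * Real.exp (δ * ⟪x, Ω⟫)) =
      ‖u * Real.exp (δ / 2 * ⟪x, Ω⟫)‖ₑ ^ 2 := by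
    rw [← enorm_pow, Real.enorm_of_nonneg (by positivity), mul_pow, ← Real.exp_nat_mul]
    congr 3
    push_cast
    ring
  simp_rw [hweight]
  have ha : 0 < 1 - δ / 2 := by linarith
  calc ∫⁻ x, ‖yukawaConv f x * Real.exp (δ / 2 * ⟪x, Ω⟫)‖ₑ ^ 2
      ≤ ∫⁻ x, (∫⁻ y, ENNReal.ofReal (yukawaKernel (1 - δ / 2) (x - y)) *
          ‖f y * Real.exp (δ / 2 * ⟪y, Ω⟫)‖ₑ) ^ 2 :=
        lintegral_mono fun x ↦
          pow_le_pow_left' (enorm_yukawaConv_mul_exp_le f (by positivity) hΩ x) 2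
    _ ≤ (∫⁻ z, ENNReal.ofReal (yukawaKernel (1 - δ / 2) z)) ^ 2 *
          ∫⁻ y, ‖f y * Real.exp (δ / 2 * ⟪y, Ω⟫)‖ₑ ^ 2 :=
        lintegral_sq_lintegral_sub_mul_le (measurable_yukawaKernel _).ennreal_ofReal
          (by fun_prop)
    _ ≤ _ := by
        rw [lintegral_yukawaKernel ha, ← ENNReal.ofReal_pow (by positivity)]
        gcongr
        have hδ : 2 - δ ≠ 0 := by linarith
        have : (1 / (1 - δ / 2) ^ 2) ^ 2 = 16 / (2 - δ) ^ 4 := by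
          rw [show 1 - δ / 2 = (2 - δ) / 2 by ring]
          field_simp
          norm_num
        rw [this]
        gcongr
        norm_num

end
end

section
/- Let Y(x) = e^{-|x|}/(4π|x|) be the Yukawa kernel on ℝ³, whose gradient is ∇Y(x) = −(1/(4π))(x/|x|³ + x/|x|²) e^{-|x|}. For every measurable f : ℝ³ → ℝ, every 0 < δ < 2 and every unit vector Ω ∈ S², one has ∫_{ℝ³} |((∇Y) ∗ f)(x)|² e^{δ(x·Ω)} dx ≤ (96/(2−δ)⁴) ∫_{ℝ³} |f(y)|² e^{δ(y·Ω)} dy, where ((∇Y) ∗ f)(x) = ∫_{ℝ³} ∇Y(x−y) f(y) dy is the ℝ³-valued convolution and |·| on the left is the Euclidean norm on ℝ³. -/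
open MeasureTheory Real
open scoped ENNReal RealInnerProductSpace

noncomputable section

/-- The gradient of the Yukawa kernel:
`∇Y(z) = -(1/(4π)) (z/|z|³ + z/|z|²) e^{-|z|}`. -/
def yukawaGrad (z : E3) : E3 :=
  (-(Real.exp (-‖z‖) / (4 * π))) • ((1 / ‖z‖ ^ 3) • z + (1 / ‖z‖ ^ 2) • z)

/-- The `ℝ³`-valued convolution `((∇Y) ∗ f)(x) = ∫ ∇Y(x-y) f(y) dy`. -/
def yukawaGradConv (f : E3 → ℝ) (x : E3) : E3 :=
  ∫ y : E3, f y • yukawaGrad (x - y)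

/-- Young's inequality `‖g ∗ k‖₂² ≤ ‖k‖₁² ‖g‖₂²` for nonnegative extended-real functions. -/
lemma lintegral_sq_lintegral_mul_sub_le {E : Type*} [AddCommGroup E] [MeasurableSpace E]
    [MeasurableAdd₂ E] [MeasurableNeg E] (μ : Measure E) [SFinite μ] [μ.IsAddLeftInvariant]
    [μ.IsNegInvariant] {g k : E → ℝ≥0∞} (hg : Measurable g) (hk : Measurable k) :
    ∫⁻ x, (∫⁻ y, g y * k (x - y) ∂μ) ^ 2 ∂μ ≤ (∫⁻ z, k z ∂μ) ^ 2 * ∫⁻ y, g y ^ 2 ∂μ := by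
  have hsub : Measurable fun p : E × E => p.1 - p.2 := by
    simp only [sub_eq_add_neg]
    exact measurable_fst.add measurable_snd.neg
  have cauchySchwarz (x : E) : (∫⁻ y, g y * k (x - y) ∂μ) ^ 2 ≤
      (∫⁻ y, g y ^ 2 * k (x - y) ∂μ) * ∫⁻ z, k z ∂μ := by
    have hkx : Measurable fun y => k (x - y) :=
      hk.comp (hsub.comp (measurable_const.prodMk measurable_id))
    have h := ENNReal.lintegral_mul_norm_pow_le (μ := μ) (p := 1 / 2) (q := 1 / 2)
      ((hg.pow_const 2).mul hkx).aemeasurable hkx.aemeasurable (by norm_num) (by norm_num)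
      (by norm_num)
    rw [lintegral_sub_left_eq_self k x] at h
    have hfun (y : E) : (g y ^ 2 * k (x - y)) ^ (1 / 2 : ℝ) * k (x - y) ^ (1 / 2 : ℝ) =
        g y * k (x - y) := by
      rw [← ENNReal.mul_rpow_of_nonneg _ _ (by norm_num),
        show g y ^ 2 * k (x - y) * k (x - y) = (g y * k (x - y)) ^ 2 by ring,
        ← ENNReal.rpow_natCast, ← ENNReal.rpow_mul]
      norm_num
    simp only [Pi.mul_apply, hfun] at h
    refine (pow_le_pow_left' h 2).trans_eq ?_
    rw [← ENNReal.mul_rpow_of_nonneg _ _ (by norm_num), ← ENNReal.rpow_natCast,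
      ← ENNReal.rpow_mul]
    norm_num
  have hprod : Measurable fun p : E × E => g p.2 ^ 2 * k (p.1 - p.2) :=
    ((hg.comp measurable_snd).pow_const 2).mul (hk.comp hsub)
  calc ∫⁻ x, (∫⁻ y, g y * k (x - y) ∂μ) ^ 2 ∂μ
      ≤ ∫⁻ x, (∫⁻ y, g y ^ 2 * k (x - y) ∂μ) * ∫⁻ z, k z ∂μ ∂μ :=
        lintegral_mono cauchySchwarz
    _ = (∫⁻ x, ∫⁻ y, g y ^ 2 * k (x - y) ∂μ ∂μ) * ∫⁻ z, k z ∂μ :=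
        lintegral_mul_const _ hprod.lintegral_prod_right'
    _ = (∫⁻ y, ∫⁻ x, g y ^ 2 * k (x - y) ∂μ ∂μ) * ∫⁻ z, k z ∂μ := by
        rw [lintegral_lintegral_swap hprod.aemeasurable]
    _ = (∫⁻ y, g y ^ 2 * ∫⁻ z, k z ∂μ ∂μ) * ∫⁻ z, k z ∂μ := by
        congr 1
        refine lintegral_congr fun y => ?_
        have hky : Measurable fun x => k (x - y) :=
          hk.comp (hsub.comp (measurable_id.prodMk measurable_const))
        rw [lintegral_const_mul _ hky, lintegral_sub_right_eq_self k y]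
    _ = (∫⁻ z, k z ∂μ) ^ 2 * ∫⁻ y, g y ^ 2 ∂μ := by
        rw [lintegral_mul_const _ (hg.pow_const 2)]
        ring

/-- The radial profile `(1/(4π)) (1/r² + 1/r) e^{-s r}`; for `s = 1` it is the modulus of the
gradient of the Yukawa kernel. -/
def yukawaGradProfile (s r : ℝ) : ℝ :=
  Real.exp (-(s * r)) / (4 * π) * (1 / r ^ 2 + 1 / r)

lemma norm_yukawaGrad (z : E3) : ‖yukawaGrad z‖ = yukawaGradProfile 1 ‖z‖ := by
  rw [yukawaGrad, yukawaGradProfile, ← add_smul, norm_smul, norm_smul, norm_neg,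
    Real.norm_of_nonneg (by positivity), Real.norm_of_nonneg (by positivity), one_mul]
  rcases eq_or_ne ‖z‖ 0 with h | h
  · simp [h]
  · field_simp

lemma yukawaGradProfile_nonneg {s r : ℝ} (hr : 0 ≤ r) : 0 ≤ yukawaGradProfile s r := by
  unfold yukawaGradProfile
  positivity

lemma measurable_yukawaGradProfile (s : ℝ) : Measurable (yukawaGradProfile s) := by
  unfold yukawaGradProfile
  fun_prop

lemma integrableOn_one_add_mul_exp {s : ℝ} (hs : 0 < s) :
    IntegrableOn (fun t : ℝ => (1 + t) * Real.exp (-(s * t))) (Set.Ioi 0) ∧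
      ∫ t in Set.Ioi (0 : ℝ), (1 + t) * Real.exp (-(s * t)) = 1 / s + 1 / s ^ 2 := by
  have h0 := Real.integral_rpow_mul_exp_neg_mul_Ioi one_pos hs
  have h1 := Real.integral_rpow_mul_exp_neg_mul_Ioi two_pos hs
  norm_num [Real.Gamma_two] at h0 h1
  have i0 : IntegrableOn (fun t : ℝ => Real.exp (-(s * t))) (Set.Ioi 0) :=
    .of_integral_ne_zero (by rw [h0]; positivity)
  have i1 : IntegrableOn (fun t : ℝ => t * Real.exp (-(s * t))) (Set.Ioi 0) :=
    .of_integral_ne_zero (by rw [h1]; positivity)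
  simp only [add_mul, one_mul]
  refine ⟨i0.add i1, ?_⟩
  rw [integral_add i0 i1, h0, h1, one_div, one_div]

lemma lintegral_yukawaGradProfile_norm {s : ℝ} (hs : 0 < s) :
    ∫⁻ z : E3, ENNReal.ofReal (yukawaGradProfile s ‖z‖) =
      ENNReal.ofReal (1 / s + 1 / s ^ 2) := by
  obtain ⟨hint, hval⟩ := integrableOn_one_add_mul_exp hs
  have hfun : Set.EqOn (fun t : ℝ => t ^ (Module.finrank ℝ E3 - 1) • yukawaGradProfile s t)
      (fun t => 1 / (4 * π) * ((1 + t) * Real.exp (-(s * t)))) (Set.Ioi 0) := by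
    intro t ht
    have ht : t ≠ 0 := (Set.mem_Ioi.mp ht).ne'
    simp only [finrank_euclideanSpace, Fintype.card_fin, smul_eq_mul, yukawaGradProfile]
    field_simp
  have hball : (volume : Measure E3).real (Metric.ball 0 1) = π * 4 / 3 := by
    rw [Measure.real, EuclideanSpace.volume_ball_fin_three, ENNReal.ofReal_one, one_pow, one_mul,
      ENNReal.toReal_ofReal (by positivity)]
  rw [← ofReal_integral_eq_lintegral_ofReal
    ((integrable_fun_norm_addHaar volume).2
      ((integrableOn_congr_fun hfun measurableSet_Ioi).2 (hint.const_mul _)))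
    (.of_forall fun z => yukawaGradProfile_nonneg (norm_nonneg z)),
    integral_fun_norm_addHaar volume (yukawaGradProfile s),
    setIntegral_congr_fun measurableSet_Ioi hfun, integral_const_mul, hval, hball]
  congr 1
  simp only [finrank_euclideanSpace, Fintype.card_fin, nsmul_eq_mul, smul_eq_mul]
  field_simp
  norm_num

/-- Moving half of the exponential weight through the convolution costs at most a factor
`e^{δ|z|/2}` in the kernel. -/
lemma yukawaGradProfile_mul_exp_le {δ : ℝ} (hδ : 0 ≤ δ) {Ω : E3} (hΩ : ‖Ω‖ = 1) (z : E3) :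
    yukawaGradProfile 1 ‖z‖ * Real.exp (δ / 2 * ⟪z, Ω⟫) ≤
      yukawaGradProfile (1 - δ / 2) ‖z‖ := by
  have hz : ⟪z, Ω⟫ ≤ ‖z‖ := by simpa [hΩ] using real_inner_le_norm z Ω
  have hexp : Real.exp (-(1 * ‖z‖)) * Real.exp (δ / 2 * ⟪z, Ω⟫) ≤
      Real.exp (-((1 - δ / 2) * ‖z‖)) := by
    rw [← Real.exp_add]
    exact Real.exp_le_exp.2 (by nlinarith)
  unfold yukawaGradProfile
  calc _ = Real.exp (-(1 * ‖z‖)) * Real.exp (δ / 2 * ⟪z, Ω⟫) / (4 * π) *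
        (1 / ‖z‖ ^ 2 + 1 / ‖z‖) := by ring
    _ ≤ _ := by gcongr

lemma enorm_yukawaGradConv_mul_exp_le (f : E3 → ℝ) {δ : ℝ} (hδ : 0 ≤ δ) {Ω : E3}
    (hΩ : ‖Ω‖ = 1) (x : E3) :
    ‖yukawaGradConv f x‖ₑ * ENNReal.ofReal (Real.exp (δ / 2 * ⟪x, Ω⟫)) ≤
      ∫⁻ y, ENNReal.ofReal (|f y| * Real.exp (δ / 2 * ⟪y, Ω⟫)) *
        ENNReal.ofReal (yukawaGradProfile (1 - δ / 2) ‖x - y‖) := by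
  calc _ ≤ (∫⁻ y, ‖f y • yukawaGrad (x - y)‖ₑ) *
        ENNReal.ofReal (Real.exp (δ / 2 * ⟪x, Ω⟫)) := by
        gcongr
        exact enorm_integral_le_lintegral_enorm _
    _ = ∫⁻ y, ‖f y • yukawaGrad (x - y)‖ₑ * ENNReal.ofReal (Real.exp (δ / 2 * ⟪x, Ω⟫)) :=
        (lintegral_mul_const' _ _ ENNReal.ofReal_ne_top).symm
    _ ≤ _ := by
        refine lintegral_mono fun y => ?_
        rw [← ofReal_norm, norm_smul, Real.norm_eq_abs, norm_yukawaGrad,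
          ← ENNReal.ofReal_mul (mul_nonneg (abs_nonneg _)
            (yukawaGradProfile_nonneg (norm_nonneg _))),
          ← ENNReal.ofReal_mul (by positivity)]
        refine ENNReal.ofReal_le_ofReal ?_
        have hsplit : Real.exp (δ / 2 * ⟪x, Ω⟫) =
            Real.exp (δ / 2 * ⟪y, Ω⟫) * Real.exp (δ / 2 * ⟪x - y, Ω⟫) := by
          rw [← Real.exp_add, inner_sub_left]
          ring_nf
        calc _ = |f y| * Real.exp (δ / 2 * ⟪y, Ω⟫) *
              (yukawaGradProfile 1 ‖x - y‖ * Real.exp (δ / 2 * ⟪x - y, Ω⟫)) := by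
              rw [hsplit]; ring
          _ ≤ _ := by
              gcongr
              exact yukawaGradProfile_mul_exp_le hδ hΩ _

/-- Weighted `L²` bound for the gradient of the Yukawa potential:
`∫ |(∇Y ∗ f)(x)|² e^{δ (x·Ω)} dx ≤ 96/(2-δ)⁴ ∫ |f(y)|² e^{δ (y·Ω)} dy`. -/
theorem yukawa_grad_weighted_L2_bound (f : E3 → ℝ) (hf : Measurable f)
    (δ : ℝ) (hδ0 : 0 < δ) (hδ2 : δ < 2) (Ω : E3) (hΩ : ‖Ω‖ = 1) :
    ∫⁻ x : E3, ENNReal.ofReal (‖yukawaGradConv f x‖ ^ 2 * Real.exp (δ * ⟪x, Ω⟫)) ≤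
      ENNReal.ofReal (96 / (2 - δ) ^ 4) *
        ∫⁻ y : E3, ENNReal.ofReal ((f y) ^ 2 * Real.exp (δ * ⟪y, Ω⟫)) := by
  have hexp (x : E3) : Real.exp (δ * ⟪x, Ω⟫) = Real.exp (δ / 2 * ⟪x, Ω⟫) ^ 2 := by
    rw [← Real.exp_nat_mul]
    push_cast
    ring_nf
  have hs : 0 < 1 - δ / 2 := by linarith
  calc _ = ∫⁻ x, (‖yukawaGradConv f x‖ₑ * ENNReal.ofReal (Real.exp (δ / 2 * ⟪x, Ω⟫))) ^ 2 := by
        refine lintegral_congr fun x => ?_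
        rw [hexp, ← mul_pow, ENNReal.ofReal_pow (by positivity),
          ENNReal.ofReal_mul (norm_nonneg _), ofReal_norm]
    _ ≤ ∫⁻ x, (∫⁻ y, ENNReal.ofReal (|f y| * Real.exp (δ / 2 * ⟪y, Ω⟫)) *
        ENNReal.ofReal (yukawaGradProfile (1 - δ / 2) ‖x - y‖)) ^ 2 :=
        lintegral_mono fun x =>
          pow_le_pow_left' (enorm_yukawaGradConv_mul_exp_le f hδ0.le hΩ x) 2
    _ ≤ (∫⁻ z : E3, ENNReal.ofReal (yukawaGradProfile (1 - δ / 2) ‖z‖)) ^ 2 *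
        ∫⁻ y, ENNReal.ofReal (|f y| * Real.exp (δ / 2 * ⟪y, Ω⟫)) ^ 2 :=
        lintegral_sq_lintegral_mul_sub_le volume
          (g := fun y => ENNReal.ofReal (|f y| * Real.exp (δ / 2 * ⟪y, Ω⟫)))
          (k := fun z => ENNReal.ofReal (yukawaGradProfile (1 - δ / 2) ‖z‖))
          (by fun_prop) ((measurable_yukawaGradProfile _).comp measurable_norm).ennreal_ofReal
    _ ≤ _ := by
        refine mul_le_mul' ?_ (lintegral_mono fun y => ?_)
        · rw [lintegral_yukawaGradProfile_norm hs, ← ENNReal.ofReal_pow (by positivity)]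
          refine ENNReal.ofReal_le_ofReal ?_
          have h : 1 / (1 - δ / 2) + 1 / (1 - δ / 2) ^ 2 = (8 - 2 * δ) / (2 - δ) ^ 2 := by
            have h2 : 2 - δ ≠ 0 := by linarith
            rw [show 1 - δ / 2 = (2 - δ) / 2 by ring]
            field_simp
            ring
          rw [h, div_pow, ← pow_mul]
          gcongr
          nlinarith
        · rw [← ENNReal.ofReal_pow (by positivity), mul_pow, sq_abs, ← hexp]

end
end

section
/- Fix η ∈ ℝ and set κ = 1/(1+η²). Let 𝒟(η) be the real 5×5 matrix with rows and columns indexed by 0,…,4 whose only nonzero entries are 𝒟₀₁ = 1, 𝒟₁₀ = 1+κ, 𝒟₁₄ = √(2/3) and 𝒟₄₁ = √(2/3). Then: (i) 𝒟(η) E_{±1} = u_{±1} E_{±1}, where u_{±1} = ∓√(5/3 + κ) and E_{±1} = (1/√(10/3 + 2κ), ∓√2/2, 0, 0, 1/√(5 + 3κ)); (ii) 𝒟(η) E₀ = 0, where E₀ = (1/√((1+κ) + (3/2)(1+κ)²), 0, 0, 0, −√(1+κ)/√(5/3 + κ)); (iii) 𝒟(η) e₂ = 𝒟(η) e₃ =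 0, where e₂, e₃ are the standard basis vectors with a 1 in position 2, respectively 3; (iv) with respect to the inner product ⟨f, g⟩_η := Σ_{i=0}^{4} f_i g_i + κ f₀ g₀ on ℝ⁵, the five vectors E_{−1}, E₀, E₁, e₂, e₃ are orthonormal: ⟨E_j, E_k⟩_η = δ_{jk} for j, k ∈ {−1, 0, 1} and analogously when e₂ or e₃ is involved. -/
noncomputable section

/-- `κ = 1/(1+η²)`. -/
def kpa (η : ℝ) : ℝ := 1 / (1 + η ^ 2)

/-- The matrix `𝒟(η)` with nonzero entries `𝒟₀₁ = 1`, `𝒟₁₀ = 1+κ`, `𝒟₁₄ = 𝒟₄₁ = √(2/3)`. -/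
def Dmat (η : ℝ) : Matrix (Fin 5) (Fin 5) ℝ :=
  !![0, 1, 0, 0, 0;
     1 + kpa η, 0, 0, 0, Real.sqrt (2 / 3);
     0, 0, 0, 0, 0;
     0, 0, 0, 0, 0;
     0, Real.sqrt (2 / 3), 0, 0, 0]

/-- `E₁(η)`, the eigenvector for the eigenvalue `u₁ = -√(5/3+κ)`. -/
def Eplus (η : ℝ) : Fin 5 → ℝ :=
  ![1 / Real.sqrt (10 / 3 + 2 * kpa η), -(Real.sqrt 2 / 2), 0, 0,
    1 / Real.sqrt (5 + 3 * kpa η)]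

/-- `E₋₁(η)`, the eigenvector for the eigenvalue `u₋₁ = √(5/3+κ)`. -/
def Eminus (η : ℝ) : Fin 5 → ℝ :=
  ![1 / Real.sqrt (10 / 3 + 2 * kpa η), Real.sqrt 2 / 2, 0, 0,
    1 / Real.sqrt (5 + 3 * kpa η)]

/-- `E₀(η)`, an eigenvector for the eigenvalue `0`. -/
def Ezero (η : ℝ) : Fin 5 → ℝ :=
  ![1 / Real.sqrt ((1 + kpa η) + (3 / 2) * (1 + kpa η) ^ 2), 0, 0, 0,
    -(Real.sqrt (1 + kpa η) / Real.sqrt (5 / 3 + kpa η))]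

/-- The standard basis vector `e₂`. -/
def eTwo : Fin 5 → ℝ := ![0, 0, 1, 0, 0]

/-- The standard basis vector `e₃`. -/
def eThree : Fin 5 → ℝ := ![0, 0, 0, 1, 0]

/-- The weighted inner product `⟨f,g⟩_η = Σᵢ fᵢ gᵢ + κ f₀ g₀` on `ℝ⁵`. -/
def ipEta (η : ℝ) (f g : Fin 5 → ℝ) : ℝ := (∑ i, f i * g i) + kpa η * (f 0 * g 0)

lemma kpa_pos (η : ℝ) : 0 < kpa η := by
  unfold kpa
  positivity

lemma sqrt_two_thirds : Real.sqrt (2 / 3) = Real.sqrt 2 / Real.sqrt 3 :=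
  Real.sqrt_div (by norm_num) 3

lemma sqrt_ten_thirds_add (k : ℝ) :
    Real.sqrt (10 / 3 + 2 * k) = Real.sqrt 2 * Real.sqrt (5 / 3 + k) := by
  rw [← Real.sqrt_mul (by norm_num)]
  congr 1
  ring

lemma sqrt_five_add (k : ℝ) :
    Real.sqrt (5 + 3 * k) = Real.sqrt 3 * Real.sqrt (5 / 3 + k) := by
  rw [← Real.sqrt_mul (by norm_num)]
  congr 1
  ring

lemma sqrt_one_add_add_sq {k : ℝ} (hk : 0 < k) :
    Real.sqrt ((1 + k) + (3 / 2) * (1 + k) ^ 2) =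
      Real.sqrt 3 / Real.sqrt 2 * Real.sqrt (1 + k) * Real.sqrt (5 / 3 + k) := by
  rw [← Real.sqrt_div (by norm_num), ← Real.sqrt_mul (by norm_num),
    ← Real.sqrt_mul (by positivity)]
  congr 1
  ring

/-- Explicit spectral decomposition of `𝒟(η)`: the eigenvalue equations for
`E_{±1}, E₀, e₂, e₃` and the orthonormality of these five vectors with respect
to `⟨·,·⟩_η`. -/
theorem Dmat_spectral_decomposition (η : ℝ) :
    (Dmat η).mulVec (Eplus η) = (-Real.sqrt (5 / 3 + kpa η)) • Eplus η ∧
    (Dmat η).mulVec (Eminus η) = Real.sqrt (5 / 3 + kpa η) • Eminus η ∧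
    (Dmat η).mulVec (Ezero η) = 0 ∧
    (Dmat η).mulVec eTwo = 0 ∧
    (Dmat η).mulVec eThree = 0 ∧
    (∀ j k : Fin 5,
      ipEta η (![Eminus η, Ezero η, Eplus η, eTwo, eThree] j)
        (![Eminus η, Ezero η, Eplus η, eTwo, eThree] k) = if j = k then 1 else 0) := by
  have hk := kpa_pos η
  simp only [Dmat, Eplus, Eminus, Ezero, eTwo, eThree, ipEta, sqrt_two_thirds,
    sqrt_ten_thirds_add, sqrt_five_add, sqrt_one_add_add_sq hk]
  generalize kpa η = k at hk ⊢
  have hq : 0 < Real.sqrt 2 := by positivity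
  have hr : 0 < Real.sqrt 3 := by positivity
  have ht : 0 < Real.sqrt (1 + k) := by positivity
  have hs : 0 < Real.sqrt (5 / 3 + k) := by positivity
  have hq2 : Real.sqrt 2 ^ 2 = 2 := Real.sq_sqrt (by norm_num)
  have hr2 : Real.sqrt 3 ^ 2 = 3 := Real.sq_sqrt (by norm_num)
  have ht2 : Real.sqrt (1 + k) ^ 2 = 1 + k := Real.sq_sqrt (by positivity)
  have hs2 : Real.sqrt (5 / 3 + k) ^ 2 = 5 / 3 + k := Real.sq_sqrt (by positivity)
  generalize Real.sqrt 2 = q at *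
  generalize Real.sqrt 3 = r at *
  generalize Real.sqrt (1 + k) = t at *
  generalize Real.sqrt (5 / 3 + k) = s at *
  obtain rfl : k = t ^ 2 - 1 := by linarith
  have hts : t ^ 2 = s ^ 2 - 2 / 3 := by linarith
  refine ⟨?_, ?_, ?_, ?_, ?_, ?_⟩
  iterate 5
    ext i
    fin_cases i <;> simp [Matrix.mulVec, dotProduct, Fin.sum_univ_succ] <;> field_simp <;> grind
  intro j k
  fin_cases j <;> fin_cases k <;> simp [Fin.sum_univ_succ] <;> field_simp <;> grind

end
end

section
/- Let η > 1 and D > 4/(η² − η). There exists a constant C > 0 such that for every t ≥ 0, every x ∈ ℝ³ and every multi-index α ∈ ℕ³ with |α| ≤ 1, ∫_{ℝ³} |∂_x^α(|x−y|^{−1} e^{−|x−y|})| e^{−|y|²/(D(1+t))} dy ≤ C e^{−|x|²/(η²D(1+t))} + C e^{−(|x|+t)/(η²D)}. -/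
open MeasureTheory Real
open scoped ENNReal

noncomputable section

/-- The kernel `z ↦ |z|⁻¹ e^{-|z|}`. -/
def Yk (z : E3) : ℝ := ‖z‖⁻¹ * Real.exp (-‖z‖)

/-- Away from the origin the directional derivatives of the kernel are at most
`(|z|⁻² + |z|⁻¹) e^{-|z|}`. -/
theorem abs_fderiv_Yk_le {z : E3} (hz : z ≠ 0) (i : Fin 3) :
    |fderiv ℝ Yk z (EuclideanSpace.single i 1)| ≤
      ((‖z‖ ^ 2)⁻¹ + ‖z‖⁻¹) * Real.exp (-‖z‖) := by
  have hr : 0 < ‖z‖ := norm_pos_iff.2 hz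
  have hn : DifferentiableAt ℝ (fun z : E3 => ‖z‖) z := differentiableAt_id.norm ℝ hz
  have hh : HasDerivAt (fun r : ℝ => r⁻¹ * Real.exp (-r))
      (-(((‖z‖ ^ 2)⁻¹ + ‖z‖⁻¹) * Real.exp (-‖z‖))) ‖z‖ := by
    have h := (hasDerivAt_inv hr.ne').mul (hasDerivAt_neg ‖z‖).exp
    refine h.congr_deriv ?_
    ring
  have hc : HasFDerivAt Yk (-(((‖z‖ ^ 2)⁻¹ + ‖z‖⁻¹) * Real.exp (-‖z‖)) •
      fderiv ℝ (fun z : E3 => ‖z‖) z) z :=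
    hh.comp_hasFDerivAt z hn.hasFDerivAt
  have hle : |fderiv ℝ (fun z : E3 => ‖z‖) z (EuclideanSpace.single i 1)| ≤ 1 := by
    have h1 : ‖fderiv ℝ (fun z : E3 => ‖z‖) z‖ ≤ 1 := by
      simpa using norm_fderiv_le_of_lipschitz ℝ (lipschitzWith_one_norm (E := E3)) (x₀ := z)
    have h2 := (fderiv ℝ (fun z : E3 => ‖z‖) z).le_of_opNorm_le h1 (EuclideanSpace.single i 1)
    simpa using h2
  have hk : 0 ≤ ((‖z‖ ^ 2)⁻¹ + ‖z‖⁻¹) * Real.exp (-‖z‖) := by positivity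
  rw [hc.fderiv, smul_apply, smul_eq_mul, abs_mul, abs_neg, abs_of_nonneg hk]
  exact mul_le_of_le_one_right hk hle

theorem abs_Yk_le (z : E3) : |Yk z| ≤ ((‖z‖ ^ 2)⁻¹ + ‖z‖⁻¹) * Real.exp (-‖z‖) := by
  have h : 0 ≤ Yk z := by unfold Yk; positivity
  rw [abs_of_nonneg h, Yk]
  gcongr
  have : 0 ≤ (‖z‖ ^ 2)⁻¹ := by positivity
  linarith

theorem integrable_kernel_mul_exp_neg_half :
    Integrable (fun z : E3 => ((‖z‖ ^ 2)⁻¹ + ‖z‖⁻¹) * Real.exp (-(‖z‖ / 2))) := by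
  rw [integrable_fun_norm_addHaar (μ := (volume : Measure E3))
    (f := fun r : ℝ => ((r ^ 2)⁻¹ + r⁻¹) * Real.exp (-(r / 2)))]
  have h0 : IntegrableOn (fun r : ℝ => Real.exp (-(1 / 2) * r)) (Set.Ioi 0) :=
    exp_neg_integrableOn_Ioi 0 (by norm_num)
  have h1 : IntegrableOn (fun r : ℝ => r ^ (1 : ℝ) * Real.exp (-(1 / 2) * r ^ (1 : ℝ)))
      (Set.Ioi 0) :=
    integrableOn_rpow_mul_exp_neg_mul_rpow (by norm_num) one_pos (by norm_num)
  refine (h0.add h1).congr_fun (fun r hr => ?_) measurableSet_Ioi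
  have hr' : r ≠ 0 := (Set.mem_Ioi.1 hr).ne'
  have he : -(1 / 2) * r = -(r / 2) := by ring
  simp only [Pi.add_apply, Real.rpow_one, finrank_euclideanSpace, Fintype.card_fin, smul_eq_mul, he]
  field_simp
  ring

/-- Half of the exponential decay of the kernel suffices to dominate the shifted Gaussian. -/
theorem exp_neg_half_mul_gaussian_le {η D t : ℝ} (hη : 1 < η) (hD : 4 / (η ^ 2 - η) < D)
    (ht : 0 ≤ t) {E : Type*} [SeminormedAddCommGroup E] (x y : E) :
    Real.exp (-(‖x - y‖ / 2)) * Real.exp (-‖y‖ ^ 2 / (D * (1 + t))) ≤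
      Real.exp (-‖x‖ ^ 2 / (η ^ 2 * D * (1 + t))) + Real.exp (-(‖x‖ + t) / (η ^ 2 * D)) := by
  have hη0 : 0 < η := by linarith
  have hq : 0 < η ^ 2 - η := by nlinarith
  have hD0 : 0 < D := lt_trans (by positivity) hD
  have hDq : 4 < D * (η ^ 2 - η) := (div_lt_iff₀ hq).1 hD
  have ha : 0 < 1 + t := by linarith
  have hx := norm_nonneg x
  have hy := norm_nonneg y
  have htri : ‖x‖ ≤ ‖x - y‖ + ‖y‖ := norm_le_norm_sub_add x y
  rw [← Real.exp_add]
  have hy2 : 0 ≤ ‖y‖ ^ 2 / (D * (1 + t)) := by positivity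
  rcases le_total ‖x‖ (η * ‖y‖) with hxy | hxy
  · refine le_add_of_le_of_nonneg (Real.exp_le_exp.2 ?_) (Real.exp_nonneg _)
    have : ‖x‖ ^ 2 / (η ^ 2 * D * (1 + t)) ≤ ‖y‖ ^ 2 / (D * (1 + t)) := by
      rw [div_le_div_iff₀ (by positivity) (by positivity)]
      have h2 : ‖x‖ ^ 2 ≤ (η * ‖y‖) ^ 2 := by gcongr
      calc ‖x‖ ^ 2 * (D * (1 + t)) ≤ (η * ‖y‖) ^ 2 * (D * (1 + t)) := by gcongr
        _ = _ := by ring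
    rw [neg_div, neg_div]
    linarith [norm_nonneg (x - y)]
  have hr : (η - 1) * ‖x‖ ≤ η * ‖x - y‖ := by nlinarith
  rcases le_total (2 * ‖x‖) (D * (η ^ 2 - η) * (1 + t)) with hs | hs
  · refine le_add_of_le_of_nonneg (Real.exp_le_exp.2 ?_) (Real.exp_nonneg _)
    have : ‖x‖ ^ 2 / (η ^ 2 * D * (1 + t)) ≤ ‖x - y‖ / 2 := by
      rw [div_le_div_iff₀ (by positivity) (by positivity)]
      calc ‖x‖ ^ 2 * 2 = ‖x‖ * (2 * ‖x‖) := by ring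
        _ ≤ ‖x‖ * (D * (η ^ 2 - η) * (1 + t)) := by gcongr
        _ = (η - 1) * ‖x‖ * (η * D * (1 + t)) := by ring
        _ ≤ η * ‖x - y‖ * (η * D * (1 + t)) := by gcongr
        _ = _ := by ring
    rw [neg_div, neg_div]
    linarith
  · refine le_add_of_nonneg_of_le (Real.exp_nonneg _) (Real.exp_le_exp.2 ?_)
    have : (‖x‖ + t) / (η ^ 2 * D) ≤ ‖x - y‖ / 2 := by
      rw [div_le_div_iff₀ (by positivity) (by positivity)]
      have hxt : 2 * (1 + t) ≤ ‖x‖ := by nlinarith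
      calc (‖x‖ + t) * 2 ≤ 4 * ‖x‖ := by linarith
        _ ≤ D * (η ^ 2 - η) * ‖x‖ := by gcongr
        _ = (η - 1) * ‖x‖ * (η * D) := by ring
        _ ≤ η * ‖x - y‖ * (η * D) := by gcongr
        _ = _ := by ring
    rw [neg_div, neg_div]
    linarith

/-- For `η > 1` and `D > 4/(η²-η)` there is `C > 0` such that for every derivative
`∂_x^α` of the kernel `|z|⁻¹ e^{-|z|}` of order `|α| ≤ 1`, all `t ≥ 0` and `x ∈ ℝ³`,
`∫ |∂_x^α(|x-y|⁻¹ e^{-|x-y|})| e^{-|y|²/(D(1+t))} dy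
  ≤ C e^{-|x|²/(η²D(1+t))} + C e^{-(|x|+t)/(η²D)}`. -/
theorem yukawa_kernel_gaussian_conv (η D : ℝ) (hη : 1 < η) (hD : 4 / (η ^ 2 - η) < D) :
    ∃ C > (0 : ℝ), ∀ g : E3 → ℝ,
      (g = Yk ∨ ∃ i : Fin 3, g = fun z => fderiv ℝ Yk z (EuclideanSpace.single i 1)) →
      ∀ t : ℝ, 0 ≤ t → ∀ x : E3,
        ∫⁻ y : E3, ENNReal.ofReal (|g (x - y)| * Real.exp (-‖y‖ ^ 2 / (D * (1 + t)))) ≤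
          ENNReal.ofReal (C * Real.exp (-‖x‖ ^ 2 / (η ^ 2 * D * (1 + t))) +
            C * Real.exp (-(‖x‖ + t) / (η ^ 2 * D))) := by
  set K : E3 → ℝ := fun z => ((‖z‖ ^ 2)⁻¹ + ‖z‖⁻¹) * Real.exp (-(‖z‖ / 2)) with hK
  have hK0 : ∀ z, 0 ≤ K z := fun z => by simp only [hK]; positivity
  have hI : 0 ≤ ∫ z, K z := integral_nonneg hK0
  refine ⟨(∫ z, K z) + 1, by linarith, fun g hg t ht x => ?_⟩
  have hbound : ∀ z : E3, z ≠ 0 → |g z| ≤ K z * Real.exp (-(‖z‖ / 2)) := by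
    intro z hz
    have he : Real.exp (-‖z‖) = Real.exp (-(‖z‖ / 2)) * Real.exp (-(‖z‖ / 2)) := by
      rw [← Real.exp_add]; ring_nf
    simp only [hK]
    rw [mul_assoc, ← he]
    rcases hg with rfl | ⟨i, rfl⟩
    · exact abs_Yk_le z
    · exact abs_fderiv_Yk_le hz i
  set B : ℝ := Real.exp (-‖x‖ ^ 2 / (η ^ 2 * D * (1 + t))) +
    Real.exp (-(‖x‖ + t) / (η ^ 2 * D)) with hB
  have hB0 : 0 ≤ B := by positivity
  calc ∫⁻ y : E3, ENNReal.ofReal (|g (x - y)| * Real.exp (-‖y‖ ^ 2 / (D * (1 + t))))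
      ≤ ∫⁻ y : E3, ENNReal.ofReal (K (x - y) * B) := by
        refine lintegral_mono_ae ?_
        filter_upwards [Measure.ae_ne volume x] with y hy
        refine ENNReal.ofReal_le_ofReal ?_
        calc |g (x - y)| * Real.exp (-‖y‖ ^ 2 / (D * (1 + t)))
            ≤ K (x - y) * Real.exp (-(‖x - y‖ / 2)) * Real.exp (-‖y‖ ^ 2 / (D * (1 + t))) := by
              gcongr
              exact hbound _ (sub_ne_zero.2 hy.symm)
          _ ≤ K (x - y) * B := by
              rw [mul_assoc]
              exact mul_le_mul_of_nonneg_left (exp_neg_half_mul_gaussian_le hη hD ht x y) (hK0 _)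
    _ = ∫⁻ z : E3, ENNReal.ofReal (K z * B) :=
        lintegral_sub_left_eq_self (fun z => ENNReal.ofReal (K z * B)) x
    _ = ENNReal.ofReal (∫ z, K z * B) :=
        (ofReal_integral_eq_lintegral_ofReal (integrable_kernel_mul_exp_neg_half.mul_const B)
          (Filter.Eventually.of_forall fun z => mul_nonneg (hK0 z) hB0)).symm
    _ ≤ _ := by
        refine ENNReal.ofReal_le_ofReal ?_
        rw [integral_mul_const, ← mul_add, ← hB]
        gcongr
        linarith
end
end

section
/- Let α ≥ 0, λ ≥ 0 and D, D₁ > 0, and let D₂ ≥ 12·max{D, D₁}·max{1, λ}. There exists a constant C > 0 such that for all t ≥ 0 and x ∈ ℝ³, ∫_{ℝ³} (1+t)^{−α} e^{−(|x−y|−λt)²/(D(1+t))} e^{−|y|/D₁} dy ≤ C (1+t)^{−α} e^{−3(|x|−λt)²/(2D₂(1+t))} + C e^{−3(|x|+t)/(2D₂)}. In particular, for λ = 0, ∫_{ℝ³} (1+t)^{−α} e^{−|x−y|²/(D(1+t))} e^{−|y|/D₁} dy ≤ C (1+t)^{−α} e^{−3|x|²/(2D₂(1+t))} + C e^{−3(|x|+t)/(2D₂)}.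 -/
open MeasureTheory Real
open scoped ENNReal

noncomputable section

/-- Either the diffusion-wave exponent or the exponential exponent of the target is dominated by
that of the convolution integrand, with a remainder of `q / (4 M)`. -/
lemma exponent_dichotomy {lam D D₁ D₂ M L t r s q : ℝ} (hlam : 0 ≤ lam)
    (hD : 0 < D) (hD₁ : 0 < D₁) (hDM : D ≤ M) (hD₁M : D₁ ≤ M) (hL : 1 ≤ L) (hlamL : lam ≤ L)
    (hD₂ : 12 * M * L ≤ D₂) (ht : 0 ≤ t) (hr : 0 ≤ r) (hq : |r - s| ≤ q) :
    3 * (r - lam * t) ^ 2 / (2 * D₂ * (1 + t)) + q / (4 * M) ≤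
        (s - lam * t) ^ 2 / (D * (1 + t)) + q / D₁ ∨
      3 * (r + t) / (2 * D₂) + q / (4 * M) ≤ (s - lam * t) ^ 2 / (D * (1 + t)) + q / D₁ := by
  have hM : 0 < M := hD.trans_le hDM
  have hT : 0 < 1 + t := by linarith
  have hL0 : 0 < L := by linarith
  have hq0 : 0 ≤ q := (abs_nonneg _).trans hq
  have hvD : (s - lam * t) ^ 2 / (M * (1 + t)) ≤ (s - lam * t) ^ 2 / (D * (1 + t)) := by gcongr
  have hqD : q / M ≤ q / D₁ := by gcongr
  have hv0 : 0 ≤ (s - lam * t) ^ 2 / (D * (1 + t)) := by positivity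
  have hq4 : q / (4 * M) = q / M / 4 := by field_simp
  have hqM : 0 ≤ q / M := by positivity
  have hu : 3 * (r - lam * t) ^ 2 / (2 * D₂ * (1 + t)) ≤
      (r - lam * t) ^ 2 / (8 * M * L * (1 + t)) := by
    calc _ ≤ 3 * (r - lam * t) ^ 2 / (2 * (12 * M * L) * (1 + t)) := by gcongr
      _ = _ := by field_simp; ring
  have hlt0 : 0 ≤ lam * t := by positivity
  have hlt : lam * t ≤ L * t := by gcongr
  have htL : t ≤ L * t := le_mul_of_one_le_left ht hL
  rcases le_or_gt |r - lam * t| (2 * |s - lam * t|) with hvu | hvu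
  · left
    have hsq : (r - lam * t) ^ 2 ≤ 4 * (s - lam * t) ^ 2 := by
      rw [← sq_abs (r - lam * t), ← sq_abs (s - lam * t)]
      nlinarith [abs_nonneg (r - lam * t)]
    have : (r - lam * t) ^ 2 / (8 * M * L * (1 + t)) ≤ (s - lam * t) ^ 2 / (M * (1 + t)) := by
      rw [div_le_div_iff₀ (by positivity) (by positivity)]
      have h1 : (r - lam * t) ^ 2 ≤ 8 * L * (s - lam * t) ^ 2 := by
        nlinarith [sq_nonneg (s - lam * t)]
      have h2 : 0 < M * (1 + t) := by positivity
      nlinarith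
    linarith
  · have huq : |r - lam * t| ≤ 2 * q := by
      have h := abs_sub_abs_le_abs_sub (r - lam * t) (s - lam * t)
      rw [sub_sub_sub_cancel_right] at h
      linarith
    rcases le_or_gt (2 * (L * t)) r with hrt | hrt
    · right
      have h1 : r + t ≤ 6 * q := by
        have := (le_abs_self _).trans huq
        linarith
      have h2 : 3 * (r + t) / (2 * D₂) ≤ 3 / 4 * (q / M) := by
        calc 3 * (r + t) / (2 * D₂) ≤ 3 * (6 * q) / (2 * (12 * M * 1)) := by
              gcongr
              exact (mul_le_mul_of_nonneg_left hL (by positivity)).trans hD₂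
          _ = _ := by field_simp; ring
      linarith
    · left
      have hut : |r - lam * t| ≤ 2 * (L * t) := abs_le.2 ⟨by linarith, by linarith⟩
      have : (r - lam * t) ^ 2 / (8 * M * L * (1 + t)) ≤ q / M / 2 := by
        rw [← sq_abs, sq]
        calc _ ≤ 2 * (L * (1 + t)) * (2 * q) / (8 * M * L * (1 + t)) := by
              gcongr
              nlinarith
          _ = _ := by field_simp; ring
      linarith

lemma lintegral_exp_neg_mul_norm_lt_top {c : ℝ} (hc : 0 < c) :
    ∫⁻ y : E3, ENNReal.ofReal (Real.exp (-(c * ‖y‖))) < ∞ := by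
  have hint : Integrable (fun y : E3 => Real.exp (-(c * ‖y‖))) := by
    rw [integrable_fun_norm_addHaar (μ := volume) (f := fun r => Real.exp (-(c * r)))]
    have h := integrableOn_rpow_mul_exp_neg_mul_rpow (p := 1) (s := 2) (b := c)
      (by norm_num) one_pos hc
    refine h.congr_fun (fun r _ => ?_) measurableSet_Ioi
    simp
  exact hint.lintegral_lt_top

/-- For `α ≥ 0`, `λ ≥ 0`, `D, D₁ > 0` and `D₂ ≥ 12 max{D,D₁} max{1,λ}`, there is `C > 0`
such that for all `t ≥ 0`, `x ∈ ℝ³`,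
`∫ (1+t)^{-α} e^{-(|x-y|-λt)²/(D(1+t))} e^{-|y|/D₁} dy
  ≤ C (1+t)^{-α} e^{-3(|x|-λt)²/(2D₂(1+t))} + C e^{-3(|x|+t)/(2D₂)}`
(the case `λ = 0` giving the purely diffusive bound). -/
theorem gaussian_exp_conv_bound (α lam D D₁ D₂ : ℝ) (hα : 0 ≤ α) (hlam : 0 ≤ lam)
    (hD : 0 < D) (hD₁ : 0 < D₁) (hD₂ : 12 * max D D₁ * max 1 lam ≤ D₂) :
    ∃ C > (0 : ℝ), ∀ t : ℝ, 0 ≤ t → ∀ x : E3,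
      ∫⁻ y : E3,
          ENNReal.ofReal ((1 + t) ^ (-α) *
            Real.exp (-(‖x - y‖ - lam * t) ^ 2 / (D * (1 + t))) *
            Real.exp (-‖y‖ / D₁)) ≤
        ENNReal.ofReal (C * (1 + t) ^ (-α) *
            Real.exp (-3 * (‖x‖ - lam * t) ^ 2 / (2 * D₂ * (1 + t))) +
          C * Real.exp (-3 * (‖x‖ + t) / (2 * D₂))) := by
  set M := max D D₁
  have hM : 0 < M := lt_max_of_lt_left hD
  set c := 1 / (4 * M) with hcdef
  have hfin := lintegral_exp_neg_mul_norm_lt_top (c := c) (by positivity)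
  set I := ∫⁻ y : E3, ENNReal.ofReal (Real.exp (-(c * ‖y‖)))
  refine ⟨I.toReal + 1, by positivity, fun t ht x => ?_⟩
  have hT : 0 < 1 + t := by linarith
  set A := (1 + t) ^ (-α) * Real.exp (-3 * (‖x‖ - lam * t) ^ 2 / (2 * D₂ * (1 + t))) with hA
  set B := Real.exp (-3 * (‖x‖ + t) / (2 * D₂)) with hB
  have hA0 : 0 ≤ A := by positivity
  have hB0 : 0 ≤ B := by positivity
  have hpow : (1 + t) ^ (-α) ≤ 1 :=
    Real.rpow_le_one_of_one_le_of_nonpos (by linarith) (by linarith)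
  have hpow0 : 0 ≤ (1 + t) ^ (-α) := by positivity
  have hpt : ∀ y : E3, (1 + t) ^ (-α) *
      Real.exp (-(‖x - y‖ - lam * t) ^ 2 / (D * (1 + t))) * Real.exp (-‖y‖ / D₁) ≤
      (A + B) * Real.exp (-(c * ‖y‖)) := by
    intro y
    have hq : |‖x‖ - ‖x - y‖| ≤ ‖y‖ := by
      simpa using abs_norm_sub_norm_le x (x - y)
    have hcq : c * ‖y‖ = ‖y‖ / (4 * M) := by rw [hcdef]; ring
    rw [mul_assoc, ← Real.exp_add, neg_div, neg_div, hcq]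
    rcases exponent_dichotomy hlam hD hD₁ (le_max_left _ _) (le_max_right _ _)
      (le_max_left 1 lam) (le_max_right 1 lam) hD₂ ht (norm_nonneg x) hq with h | h
    · calc _ ≤ (1 + t) ^ (-α) * Real.exp (-3 * (‖x‖ - lam * t) ^ 2 / (2 * D₂ * (1 + t)) +
            -(‖y‖ / (4 * M))) := by
            refine mul_le_mul_of_nonneg_left (Real.exp_le_exp.2 ?_) hpow0
            rw [neg_mul, neg_div]
            linarith
        _ = A * Real.exp (-(‖y‖ / (4 * M))) := by rw [Real.exp_add, hA]; ring
        _ ≤ _ := by gcongr; linarith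
    · calc _ ≤ 1 * Real.exp (-3 * (‖x‖ + t) / (2 * D₂) + -(‖y‖ / (4 * M))) := by
            refine mul_le_mul hpow (Real.exp_le_exp.2 ?_) (Real.exp_nonneg _) zero_le_one
            rw [neg_mul, neg_div]
            linarith
        _ = B * Real.exp (-(‖y‖ / (4 * M))) := by rw [Real.exp_add, hB]; ring
        _ ≤ _ := by gcongr; linarith
  calc _ ≤ ∫⁻ y : E3, ENNReal.ofReal (A + B) * ENNReal.ofReal (Real.exp (-(c * ‖y‖))) := by
        refine lintegral_mono fun y => ?_
        rw [← ENNReal.ofReal_mul (by positivity)]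
        exact ENNReal.ofReal_le_ofReal (hpt y)
    _ = ENNReal.ofReal (A + B) * I := lintegral_const_mul' _ _ ENNReal.ofReal_ne_top
    _ = ENNReal.ofReal ((A + B) * I.toReal) := by
        rw [ENNReal.ofReal_mul (by positivity), ENNReal.ofReal_toReal hfin.ne]
    _ ≤ _ := by
        refine ENNReal.ofReal_le_ofReal ?_
        rw [mul_assoc, ← hA]
        nlinarith

end
end

section
/- Let α ≥ 0, λ > 0 and D₁ > 0, and let D₂ ≥ 12·D₁·max{1, λ}. There exists a constant C > 0 such that for all t ≥ 0 and x ∈ ℝ³, ∫_{{|x−y| ≤ λt}} (1+t)^{−α} B_{3/2}(t, |x−y|) e^{−|y|/D₁} dy ≤ C (1+t)^{−α−3/2} e^{−3(|x|−λt)²/(2D₂(1+t))} + C e^{−3(|x|+t)/(2D₂)} + C (1+t)^{−α} B_{3/2}(t, |x|) 1_{{|x| ≤ λt}}. -/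
open MeasureTheory Real
open scoped ENNReal

noncomputable section

/-- The space–time diffusive profile `B_k(t,z) = (1 + z²/(1+t))^{-k}`. -/
def Bprof (k t z : ℝ) : ℝ := (1 + z ^ 2 / (1 + t)) ^ (-k)

lemma Bprof_nonneg {k t z : ℝ} (ht : 0 ≤ t) : 0 ≤ Bprof k t z := by
  unfold Bprof; positivity

lemma Bprof_le_one {k t z : ℝ} (hk : 0 ≤ k) (ht : 0 ≤ t) : Bprof k t z ≤ 1 := by
  unfold Bprof
  refine Real.rpow_le_one_of_one_le_of_nonpos ?_ (by linarith)
  have : 0 ≤ z ^ 2 / (1 + t) := by positivity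
  linarith

/-- Peetre-type inequality: the profile varies at most polynomially under translation. -/
lemma Bprof_norm_sub_le {E : Type*} [SeminormedAddCommGroup E] {k t : ℝ} (hk : 0 ≤ k)
    (ht : 0 ≤ t) (x y : E) :
    Bprof k t ‖x - y‖ ≤ 2 ^ k * (1 + ‖y‖) ^ (2 * k) * Bprof k t ‖x‖ := by
  have hy := norm_nonneg y
  have htri : ‖x‖ ≤ ‖x - y‖ + ‖y‖ := by
    simpa using norm_add_le (x - y) y
  have hx2 : ‖x‖ ^ 2 ≤ 2 * ‖x - y‖ ^ 2 + 2 * ‖y‖ ^ 2 := by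
    nlinarith [sq_nonneg (‖x - y‖ - ‖y‖), norm_nonneg x, norm_nonneg (x - y)]
  have hkey : 1 + ‖x‖ ^ 2 / (1 + t) ≤
      2 * (1 + ‖y‖) ^ 2 * (1 + ‖x - y‖ ^ 2 / (1 + t)) := by
    have hq : ‖x‖ ^ 2 / (1 + t) ≤ 2 * (‖x - y‖ ^ 2 / (1 + t)) + 2 * ‖y‖ ^ 2 := by
      have h1 : ‖x‖ ^ 2 / (1 + t) ≤ (2 * ‖x - y‖ ^ 2 + 2 * ‖y‖ ^ 2) / (1 + t) := by gcongr
      have h2 : ‖y‖ ^ 2 / (1 + t) ≤ ‖y‖ ^ 2 := div_le_self (by positivity) (by linarith)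
      have h3 : (2 * ‖x - y‖ ^ 2 + 2 * ‖y‖ ^ 2) / (1 + t) =
        2 * (‖x - y‖ ^ 2 / (1 + t)) + 2 * (‖y‖ ^ 2 / (1 + t)) := by ring
      linarith
    have hu : 0 ≤ ‖x - y‖ ^ 2 / (1 + t) := by positivity
    generalize ‖x - y‖ ^ 2 / (1 + t) = u at *
    nlinarith [mul_nonneg hu hy, mul_nonneg hu (sq_nonneg ‖y‖)]
  have hpow := Real.rpow_le_rpow (by positivity) hkey hk
  rw [Real.mul_rpow (by positivity) (by positivity),
    Real.mul_rpow (by positivity) (by positivity), ← Real.rpow_natCast (1 + ‖y‖) 2,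
    ← Real.rpow_mul (by positivity)] at hpow
  unfold Bprof
  rw [Real.rpow_neg (by positivity), Real.rpow_neg (by positivity), ← div_eq_mul_inv,
    le_div_iff₀ (by positivity), inv_mul_le_iff₀ (by positivity)]
  push_cast at hpow
  linarith

/-- Outside the cone `z ≤ λ t` the profile decays like `(1 + t)^{-k}`. -/
lemma Bprof_le_of_mul_le {k t z lam : ℝ} (hk : 0 ≤ k) (hlam : 0 < lam) (ht : 0 ≤ t)
    (hz : lam * t ≤ z) :
    Bprof k t z ≤ (min 1 (lam ^ 2) / 2) ^ (-k) * (1 + t) ^ (-k) := by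
  have hc : 0 < min 1 (lam ^ 2) := lt_min one_pos (by positivity)
  have hc1 : min 1 (lam ^ 2) ≤ 1 := min_le_left _ _
  have hc2 : min 1 (lam ^ 2) ≤ lam ^ 2 := min_le_right _ _
  unfold Bprof
  rw [← Real.mul_rpow (by positivity) (by positivity)]
  refine Real.rpow_le_rpow_of_nonpos (by positivity) ?_ (by linarith)
  have hz2 : (lam * t) ^ 2 ≤ z ^ 2 := by gcongr
  rw [← sub_le_iff_le_add', le_div_iff₀ (by linarith)]
  have h4 : min 1 (lam ^ 2) * t ^ 2 ≤ lam ^ 2 * t ^ 2 := by gcongr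
  nlinarith [mul_nonneg hc.le (sq_nonneg (1 - t))]

lemma one_add_pow_mul_exp_neg_le {a s : ℝ} (ha : 0 < a) (hs : 0 ≤ s) (n : ℕ) :
    (1 + s) ^ n * Real.exp (-(a * s)) ≤ n.factorial * Real.exp a / a ^ n := by
  have h := Real.pow_div_factorial_le_exp (a * (1 + s)) (by positivity) n
  rw [div_le_iff₀ (by positivity), mul_pow, mul_add, mul_one, Real.exp_add] at h
  rw [le_div_iff₀ (by positivity), Real.exp_neg, ← div_eq_mul_inv, div_mul_eq_mul_div,
    div_le_iff₀ (by positivity)]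
  linarith

/-- On `‖x - y‖ ≤ λ t`, the integrand is controlled by an integrable function of `y`, times the
profile at `x` and the exponential of the distance from `x` to the cone. -/
lemma Bprof_mul_exp_le {E : Type*} [SeminormedAddCommGroup E] {lam D t : ℝ} (hD : 0 < D)
    (ht : 0 ≤ t) {x y : E} (hxy : ‖x - y‖ ≤ lam * t) :
    Bprof (3 / 2) t ‖x - y‖ * Real.exp (-‖y‖ / D) ≤
      2 ^ (3 / 2 : ℝ) * ((Nat.factorial 7) * Real.exp (1 / (2 * D)) / (1 / (2 * D)) ^ 7) *
        (Bprof (3 / 2) t ‖x‖ * Real.exp (-max (‖x‖ - lam * t) 0 / (2 * D))) *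
        (1 + ‖y‖) ^ (-4 : ℝ) := by
  have hy := norm_nonneg y
  have hd : max (‖x‖ - lam * t) 0 ≤ ‖y‖ := by
    refine max_le ?_ hy
    have : ‖x‖ ≤ ‖x - y‖ + ‖y‖ := by simpa using norm_add_le (x - y) y
    linarith
  set w := max (‖x‖ - lam * t) 0
  have hB := Bprof_norm_sub_le (k := 3 / 2) (by norm_num) ht x y
  have hBx : 0 ≤ Bprof (3 / 2) t ‖x‖ := Bprof_nonneg ht
  have hexp : Real.exp (-‖y‖ / D) ≤
      Real.exp (-w / (2 * D)) * Real.exp (-(1 / (2 * D) * ‖y‖)) := by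
    rw [← Real.exp_add]
    refine Real.exp_le_exp.2 ?_
    have h1 : w / (2 * D) ≤ ‖y‖ / (2 * D) := by gcongr
    have h2 : -‖y‖ / D = -(‖y‖ / (2 * D)) - ‖y‖ / (2 * D) := by field_simp; ring
    have h3 : -w / (2 * D) + -(1 / (2 * D) * ‖y‖) = -(w / (2 * D)) - ‖y‖ / (2 * D) := by ring
    linarith
  have hpoly := one_add_pow_mul_exp_neg_le (a := 1 / (2 * D)) (by positivity) hy 7
  set M : ℝ := (Nat.factorial 7) * Real.exp (1 / (2 * D)) / (1 / (2 * D)) ^ 7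
  have hthree : (1 + ‖y‖) ^ (2 * (3 / 2) : ℝ) = (1 + ‖y‖) ^ 7 * (1 + ‖y‖) ^ (-4 : ℝ) := by
    rw [← Real.rpow_natCast, ← Real.rpow_add (by positivity)]
    norm_num
  rw [hthree] at hB
  calc Bprof (3 / 2) t ‖x - y‖ * Real.exp (-‖y‖ / D)
      ≤ (2 ^ (3 / 2 : ℝ) * ((1 + ‖y‖) ^ 7 * (1 + ‖y‖) ^ (-4 : ℝ)) * Bprof (3 / 2) t ‖x‖) *
          (Real.exp (-w / (2 * D)) * Real.exp (-(1 / (2 * D) * ‖y‖))) := by gcongr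
    _ = 2 ^ (3 / 2 : ℝ) * ((1 + ‖y‖) ^ 7 * Real.exp (-(1 / (2 * D) * ‖y‖))) *
          (Bprof (3 / 2) t ‖x‖ * Real.exp (-w / (2 * D))) * (1 + ‖y‖) ^ (-4 : ℝ) := by ring
    _ ≤ _ := by gcongr

/-- Exponential decay away from the cone is either Gaussian around the cone or exponential in
space and time. -/
lemma exp_neg_div_le_gaussian_or_exp {lam D₁ D₂ t r : ℝ} (hD₁ : 0 < D₁)
    (hD₂ : 12 * D₁ * max 1 lam ≤ D₂) (ht : 0 ≤ t) (hr : lam * t ≤ r) :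
    Real.exp (-(r - lam * t) / (2 * D₁)) ≤
        Real.exp (-3 * (r - lam * t) ^ 2 / (2 * D₂ * (1 + t))) ∨
      Real.exp (-(r - lam * t) / (2 * D₁)) ≤ Real.exp (-3 * (r + t) / (2 * D₂)) := by
  have hm1 : 1 ≤ max 1 lam := le_max_left _ _
  have hml : lam ≤ max 1 lam := le_max_right _ _
  set m := max 1 lam
  have hD₂pos : 0 < D₂ := lt_of_lt_of_le (by positivity) hD₂
  obtain ⟨d, rfl⟩ : ∃ d, r = d + lam * t := ⟨r - lam * t, by ring⟩
  have hd : 0 ≤ d := by linarith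
  simp only [add_sub_cancel_right, Real.exp_le_exp]
  rcases le_total d (4 * m * (1 + t)) with h | h
  · left
    rw [div_le_div_iff₀ (by positivity) (by positivity)]
    have h1 : D₁ * (3 * d) ≤ D₂ * (1 + t) :=
      calc D₁ * (3 * d) ≤ D₁ * (3 * (4 * m * (1 + t))) := by gcongr
        _ = 12 * D₁ * m * (1 + t) := by ring
        _ ≤ D₂ * (1 + t) := by gcongr
    nlinarith [mul_le_mul_of_nonneg_left h1 hd]
  · right
    rw [div_le_div_iff₀ (by positivity) (by positivity)]
    have hmt : lam * t ≤ m * t := by gcongr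
    have hmt' : t ≤ m * t := le_mul_of_one_le_left ht hm1
    have hmd : d ≤ m * d := le_mul_of_one_le_left hd hm1
    have h1 : d + lam * t + t ≤ 4 * (m * d) := by linarith
    have h2 : D₁ * (3 * (d + lam * t + t)) ≤ D₂ * d :=
      calc D₁ * (3 * (d + lam * t + t)) ≤ D₁ * (3 * (4 * (m * d))) := by gcongr
        _ = 12 * D₁ * m * d := by ring
        _ ≤ D₂ * d := by gcongr
    linarith

/-- For `α ≥ 0`, `λ > 0`, `D₁ > 0` and `D₂ ≥ 12 D₁ max{1,λ}`, there is `C > 0`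
such that for all `t ≥ 0`, `x ∈ ℝ³`,
`∫_{|x-y|≤λt} (1+t)^{-α} B_{3/2}(t,|x-y|) e^{-|y|/D₁} dy
  ≤ C (1+t)^{-α-3/2} e^{-3(|x|-λt)²/(2D₂(1+t))} + C e^{-3(|x|+t)/(2D₂)}
    + C (1+t)^{-α} B_{3/2}(t,|x|) 1_{|x|≤λt}`. -/
theorem diffusive_exp_conv_bound (α lam D₁ D₂ : ℝ) (hα : 0 ≤ α) (hlam : 0 < lam)
    (hD₁ : 0 < D₁) (hD₂ : 12 * D₁ * max 1 lam ≤ D₂) :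
    ∃ C > (0 : ℝ), ∀ t : ℝ, 0 ≤ t → ∀ x : E3,
      ∫⁻ y in {y : E3 | ‖x - y‖ ≤ lam * t},
          ENNReal.ofReal ((1 + t) ^ (-α) * Bprof (3 / 2) t ‖x - y‖ *
            Real.exp (-‖y‖ / D₁)) ≤
        ENNReal.ofReal (C * (1 + t) ^ (-α - 3 / 2) *
            Real.exp (-3 * (‖x‖ - lam * t) ^ 2 / (2 * D₂ * (1 + t))) +
          C * Real.exp (-3 * (‖x‖ + t) / (2 * D₂)) +
          C * (1 + t) ^ (-α) * (if ‖x‖ ≤ lam * t then Bprof (3 / 2) t ‖x‖ else 0)) := by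
  set K : ℝ := 2 ^ (3 / 2 : ℝ) *
    ((Nat.factorial 7) * Real.exp (1 / (2 * D₁)) / (1 / (2 * D₁)) ^ 7)
  have hK : 0 < K := by positivity
  set A : ℝ := (min 1 (lam ^ 2) / 2) ^ (-(3 / 2) : ℝ)
  have hc : 0 < min 1 (lam ^ 2) := lt_min one_pos (by positivity)
  have hA : 1 ≤ A := Real.one_le_rpow_of_pos_of_le_one_of_nonpos (by positivity)
    (by linarith [min_le_left 1 (lam ^ 2)]) (by norm_num)
  have hint : Integrable (fun y : E3 => (1 + ‖y‖) ^ (-4 : ℝ)) :=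
    integrable_one_add_norm (by simp [E3]; norm_num)
  set J : ℝ := ∫ y : E3, (1 + ‖y‖) ^ (-4 : ℝ)
  have hJ : 0 ≤ J := integral_nonneg fun y => by positivity
  refine ⟨K * (J + 1) * A, by positivity, fun t ht x => ?_⟩
  have hBx : 0 ≤ Bprof (3 / 2) t ‖x‖ := Bprof_nonneg ht
  set P : ℝ := (1 + t) ^ (-α) *
    (Bprof (3 / 2) t ‖x‖ * Real.exp (-max (‖x‖ - lam * t) 0 / (2 * D₁))) with hPdef
  have hP : 0 ≤ P := by positivity
  have hmeas : MeasurableSet {y : E3 | ‖x - y‖ ≤ lam * t} :=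
    measurableSet_le (by fun_prop) measurable_const
  have hbound : ∫⁻ y in {y : E3 | ‖x - y‖ ≤ lam * t},
      ENNReal.ofReal ((1 + t) ^ (-α) * Bprof (3 / 2) t ‖x - y‖ * Real.exp (-‖y‖ / D₁)) ≤
      ENNReal.ofReal (K * P * J) :=
    calc _ ≤ ∫⁻ y in {y : E3 | ‖x - y‖ ≤ lam * t},
          ENNReal.ofReal (K * P * (1 + ‖y‖) ^ (-4 : ℝ)) := by
          refine setLIntegral_mono' hmeas fun y hy => ENNReal.ofReal_le_ofReal ?_
          have h := mul_le_mul_of_nonneg_left (Bprof_mul_exp_le hD₁ ht hy)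
            (by positivity : 0 ≤ (1 + t) ^ (-α))
          rw [mul_assoc]
          exact h.trans_eq (by rw [hPdef]; ring)
      _ ≤ ∫⁻ y : E3, ENNReal.ofReal (K * P * (1 + ‖y‖) ^ (-4 : ℝ)) :=
          setLIntegral_le_lintegral _ _
      _ = ENNReal.ofReal (K * P * J) := by
          rw [← integral_const_mul, ofReal_integral_eq_lintegral_ofReal (hint.const_mul _)]
          exact .of_forall fun y => by positivity
  refine hbound.trans (ENNReal.ofReal_le_ofReal ?_)
  have hsuff : P ≤ A * ((1 + t) ^ (-α - 3 / 2) *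
        Real.exp (-3 * (‖x‖ - lam * t) ^ 2 / (2 * D₂ * (1 + t))) +
      Real.exp (-3 * (‖x‖ + t) / (2 * D₂)) +
      (1 + t) ^ (-α) * (if ‖x‖ ≤ lam * t then Bprof (3 / 2) t ‖x‖ else 0)) := by
    have hA0 : 0 ≤ A := by linarith
    have hite : 0 ≤ if ‖x‖ ≤ lam * t then Bprof (3 / 2) t ‖x‖ else 0 := by
      split_ifs <;> simp [hBx]
    set G := Real.exp (-3 * (‖x‖ - lam * t) ^ 2 / (2 * D₂ * (1 + t)))
    set F := Real.exp (-3 * (‖x‖ + t) / (2 * D₂))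
    have hG : 0 ≤ (1 + t) ^ (-α - 3 / 2) * G := by positivity
    have hF : 0 ≤ F := by positivity
    by_cases hx : ‖x‖ ≤ lam * t
    · rw [if_pos hx]
      have hQ : 0 ≤ (1 + t) ^ (-α) * Bprof (3 / 2) t ‖x‖ := by positivity
      have hPQ : P ≤ (1 + t) ^ (-α) * Bprof (3 / 2) t ‖x‖ := by
        rw [hPdef, max_eq_right (by linarith)]
        simp
      nlinarith
    · rw [if_neg hx, mul_zero, add_zero]
      have hx' : lam * t ≤ ‖x‖ := (not_le.1 hx).le
      rw [hPdef, max_eq_left (by linarith)]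
      rcases exp_neg_div_le_gaussian_or_exp hD₁ hD₂ ht hx' with h | h
      · have hB := Bprof_le_of_mul_le (k := 3 / 2) (by norm_num) hlam ht hx'
        calc _ ≤ (1 + t) ^ (-α) * (A * (1 + t) ^ (-(3 / 2) : ℝ) * G) := by gcongr
          _ = A * ((1 + t) ^ (-α - 3 / 2) * G) := by
            rw [sub_eq_add_neg, Real.rpow_add (by positivity)]
            ring
          _ ≤ _ := by gcongr; linarith
      · have h1 : (1 + t) ^ (-α) ≤ 1 :=
          Real.rpow_le_one_of_one_le_of_nonpos (by linarith) (by linarith)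
        have hB : Bprof (3 / 2) t ‖x‖ ≤ 1 := Bprof_le_one (by norm_num) ht
        calc _ ≤ 1 * (1 * F) := by gcongr
          _ ≤ A * (_ + F) := by nlinarith
  calc K * P * J ≤ K * (J + 1) * P := by nlinarith [mul_nonneg hK.le hP]
    _ ≤ K * (J + 1) * _ := mul_le_mul_of_nonneg_left hsuff (by positivity)
    _ = _ := by ring

end
end

section
/- Define, for parameters α, β, D, D₁ > 0 and μ₁, μ₂ ≥ 0, I^{α,β}(t, x; μ₁, μ₂, D, D₁) := ∫₀^t ∫_{ℝ³} (1+t−s)^{−α} e^{−(|x−y|−μ₁(t−s))²/(D(1+t−s))} (1+s)^{−β} e^{−2(|y|−μ₂s)²/(D₁(1+s))} dy ds. For given α, β > 0 and D > 0 there exist constants C > 0 and D₁ ≥ 16D such that for all t ≥ 0 and x ∈ ℝ³, I^{α,β}(t, x; 0, 0, D, D₁) ≤ C ((1+t)^{−α} Γ_{β−3/2}(t) + (1+t)^{−β} Γ_{α−3/2}(t)) e^{−3|x|²/(2D₁(1+t))}. -/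
open MeasureTheory Real
open scoped ENNReal

noncomputable section

/-- The nonlinear-interaction integral
`I^{α,β}(t,x;μ₁,μ₂,D,D₁) = ∫₀ᵗ ∫ (1+t-s)^{-α} e^{-(|x-y|-μ₁(t-s))²/(D(1+t-s))}
  (1+s)^{-β} e^{-2(|y|-μ₂ s)²/(D₁(1+s))} dy ds`. -/
def Ifun (α β μ₁ μ₂ D D₁ t : ℝ) (x : E3) : ℝ≥0∞ :=
  ∫⁻ s in Set.Icc (0 : ℝ) t, ∫⁻ y : E3,
    ENNReal.ofReal ((1 + t - s) ^ (-α) *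
      Real.exp (-(‖x - y‖ - μ₁ * (t - s)) ^ 2 / (D * (1 + t - s))) *
      (1 + s) ^ (-β) * Real.exp (-2 * (‖y‖ - μ₂ * s) ^ 2 / (D₁ * (1 + s))))

/-- `Γ_α(t) = ∫₀ᵗ (1+s)^{-α} ds`. -/
def Gam (a t : ℝ) : ℝ := ∫ s in (0 : ℝ)..t, (1 + s) ^ (-a)

lemma lintegral_gaussian_E3 {b : ℝ} (hb : 0 < b) :
    ∫⁻ y : E3, ENNReal.ofReal (exp (-b * ‖y‖ ^ 2)) = ENNReal.ofReal ((π / b) ^ (3 / 2 : ℝ)) := by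
  have h := GaussianFourier.integral_rexp_neg_mul_sq_norm (V := E3) hb
  have hpos : 0 < (π / b) ^ (3 / 2 : ℝ) := by positivity
  have hdim : (Module.finrank ℝ E3 : ℝ) / 2 = 3 / 2 := by simp
  rw [hdim] at h
  rw [← h, ofReal_integral_eq_lintegral_ofReal]
  · by_contra hni
    rw [integral_undef hni] at h
    exact hpos.ne h
  · exact Filter.Eventually.of_forall fun y => (exp_pos _).le

lemma gaussian_exponent_le {D A B T p q r : ℝ} (hD : 0 < D) (hA : 0 < A) (hB : 0 < B)
    (hAT : A ≤ T) (hBT : B ≤ T) (hr : 0 ≤ r) (hrpq : r ≤ p + q) :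
    -p ^ 2 / (D * A) + -2 * q ^ 2 / (64 * D * B) ≤
      -3 * r ^ 2 / (2 * (64 * D) * T) + (-((160 * D)⁻¹ / A) * p ^ 2 + -((160 * D)⁻¹ / B) * q ^ 2) := by
  have hT : 0 < T := hA.trans_le hAT
  have h1 : p ^ 2 / T ≤ p ^ 2 / A := by gcongr
  have h2 : q ^ 2 / T ≤ q ^ 2 / B := by gcongr
  have h3 : r ^ 2 / T ≤ (p + q) ^ 2 / T := by gcongr
  have h4 : 3 / 128 * ((p + q) ^ 2 / T) ≤ 159 / 160 * (p ^ 2 / T) + 1 / 40 * (q ^ 2 / T) := by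
    have : 3 / 128 * (p + q) ^ 2 ≤ 159 / 160 * p ^ 2 + 1 / 40 * q ^ 2 := by
      nlinarith [sq_nonneg (q - 15 * p), sq_nonneg p, sq_nonneg q]
    calc _ = 3 / 128 * (p + q) ^ 2 / T := by ring
      _ ≤ (159 / 160 * p ^ 2 + 1 / 40 * q ^ 2) / T := by gcongr
      _ = _ := by ring
  have h5 : 3 / 128 * (r ^ 2 / T) ≤ 159 / 160 * (p ^ 2 / A) + 1 / 40 * (q ^ 2 / B) := by linarith
  have h6 := mul_le_mul_of_nonneg_left h5 (inv_pos.2 hD).le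
  have e1 : -p ^ 2 / (D * A) = - (D⁻¹ * (p ^ 2 / A)) := by field_simp
  have e2 : -2 * q ^ 2 / (64 * D * B) = - (1 / 32 * (D⁻¹ * (q ^ 2 / B))) := by field_simp; ring
  have e3 : -3 * r ^ 2 / (2 * (64 * D) * T) = - (3 / 128 * (D⁻¹ * (r ^ 2 / T))) := by
    field_simp; ring
  have e4 : -((160 * D)⁻¹ / A) * p ^ 2 = - (1 / 160 * (D⁻¹ * (p ^ 2 / A))) := by field_simp
  have e5 : -((160 * D)⁻¹ / B) * q ^ 2 = - (1 / 160 * (D⁻¹ * (q ^ 2 / B))) := by field_simp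
  rw [e1, e2, e3, e4, e5]
  linarith

lemma lintegral_coupled_gaussian_le {D A B T : ℝ} (hD : 0 < D) (hA : 0 < A) (hB : 0 < B)
    (hAT : A ≤ T) (hBT : B ≤ T) (x : E3) :
    ∫⁻ y : E3, ENNReal.ofReal (exp (-‖x - y‖ ^ 2 / (D * A)) *
        exp (-2 * ‖y‖ ^ 2 / (64 * D * B))) ≤
      ENNReal.ofReal (exp (-3 * ‖x‖ ^ 2 / (2 * (64 * D) * T)) *
        ((160 * π * D) ^ (3 / 2 : ℝ) * (min A B) ^ (3 / 2 : ℝ))) := by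
  have hK {M : ℝ} (hM : 0 < M) : (π / ((160 * D)⁻¹ / M)) ^ (3 / 2 : ℝ) =
      (160 * π * D) ^ (3 / 2 : ℝ) * M ^ (3 / 2 : ℝ) := by
    rw [← mul_rpow (by positivity) hM.le]
    congr 1
    field_simp
  have key (y : E3) := gaussian_exponent_le (p := ‖x - y‖) (q := ‖y‖) hD hA hB hAT hBT
    (norm_nonneg x) (by simpa using norm_add_le (x - y) y)
  have hE : 0 ≤ exp (-3 * ‖x‖ ^ 2 / (2 * (64 * D) * T)) := (exp_pos _).le
  rcases min_cases A B with ⟨h, -⟩ | ⟨h, -⟩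
  · rw [h, ← hK hA, ENNReal.ofReal_mul hE, ← lintegral_gaussian_E3 (by positivity),
      ← lintegral_sub_left_eq_self
        (fun y => ENNReal.ofReal (exp (-((160 * D)⁻¹ / A) * ‖y‖ ^ 2))) x,
      ← lintegral_const_mul' _ _ ENNReal.ofReal_ne_top]
    refine lintegral_mono fun y => ?_
    rw [← ENNReal.ofReal_mul hE, ← exp_add, ← exp_add]
    refine ENNReal.ofReal_le_ofReal (exp_le_exp.2 ((key y).trans ?_))
    have : 0 ≤ ((160 * D)⁻¹ / B) * ‖y‖ ^ 2 := by positivity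
    linarith
  · rw [h, ← hK hB, ENNReal.ofReal_mul hE, ← lintegral_gaussian_E3 (by positivity),
      ← lintegral_const_mul' _ _ ENNReal.ofReal_ne_top]
    refine lintegral_mono fun y => ?_
    rw [← ENNReal.ofReal_mul hE, ← exp_add, ← exp_add]
    refine ENNReal.ofReal_le_ofReal (exp_le_exp.2 ((key y).trans ?_))
    have : 0 ≤ ((160 * D)⁻¹ / A) * ‖x - y‖ ^ 2 := by positivity
    linarith

lemma rpow_neg_le_of_half_le {α A T : ℝ} (hα : 0 ≤ α) (hT : 0 < T) (h : T / 2 ≤ A) :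
    A ^ (-α) ≤ 2 ^ α * T ^ (-α) := by
  calc A ^ (-α) ≤ (T / 2) ^ (-α) := rpow_le_rpow_of_nonpos (by positivity) h (by linarith)
    _ = 2 ^ α * T ^ (-α) := by
      rw [div_rpow hT.le (by norm_num), rpow_neg (x := 2) (by norm_num)]
      field_simp

lemma rpow_mul_rpow_mul_min_le {α β A B T : ℝ} (hα : 0 ≤ α) (hβ : 0 ≤ β) (hA : 0 < A)
    (hB : 0 < B) (hT : 0 < T) (hAB : T ≤ A + B) :
    A ^ (-α) * B ^ (-β) * (min A B) ^ (3 / 2 : ℝ) ≤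
      (2 ^ α + 2 ^ β) * (T ^ (-α) * B ^ (-(β - 3 / 2)) + T ^ (-β) * A ^ (-(α - 3 / 2))) := by
  have split {M γ : ℝ} (hM : 0 < M) : M ^ (-(γ - 3 / 2)) = M ^ (-γ) * M ^ (3 / 2 : ℝ) := by
    rw [← rpow_add hM]; congr 1; ring
  rw [split hA, split hB]
  have pA := rpow_pos_of_pos hA
  have pB := rpow_pos_of_pos hB
  have pT := rpow_pos_of_pos hT
  have p2 := rpow_pos_of_pos (zero_lt_two (α := ℝ))
  have hX : 0 ≤ T ^ (-α) * (B ^ (-β) * B ^ (3 / 2 : ℝ)) := by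
    have := pT (-α); have := pB (-β); have := pB (3 / 2); positivity
  have hY : 0 ≤ T ^ (-β) * (A ^ (-α) * A ^ (3 / 2 : ℝ)) := by
    have := pT (-β); have := pA (-α); have := pA (3 / 2); positivity
  have h2α := (p2 α).le
  have h2β := (p2 β).le
  rcases le_total A B with h | h
  · rw [min_eq_left h]
    have h1 := rpow_neg_le_of_half_le hβ hT (A := B) (by linarith)
    calc _ = B ^ (-β) * (A ^ (-α) * A ^ (3 / 2 : ℝ)) := by ring
      _ ≤ 2 ^ β * T ^ (-β) * (A ^ (-α) * A ^ (3 / 2 : ℝ)) :=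
        mul_le_mul_of_nonneg_right h1 (mul_nonneg (pA _).le (pA _).le)
      _ ≤ _ := by
        nlinarith [mul_nonneg h2α hX, mul_nonneg h2α hY, mul_nonneg h2β hX]
  · rw [min_eq_right h]
    have h1 := rpow_neg_le_of_half_le hα hT (A := A) (by linarith)
    calc _ = A ^ (-α) * (B ^ (-β) * B ^ (3 / 2 : ℝ)) := by ring
      _ ≤ 2 ^ α * T ^ (-α) * (B ^ (-β) * B ^ (3 / 2 : ℝ)) :=
        mul_le_mul_of_nonneg_right h1 (mul_nonneg (pB _).le (pB _).le)
      _ ≤ _ := by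
        nlinarith [mul_nonneg h2β hX, mul_nonneg h2α hY, mul_nonneg h2β hY]

lemma continuousOn_one_add_rpow (a t : ℝ) :
    ContinuousOn (fun s : ℝ => (1 + s) ^ (-a)) (Set.Icc 0 t) :=
  ContinuousOn.rpow_const (by fun_prop) fun s hs => Or.inl (by linarith [hs.1])

lemma continuousOn_one_add_sub_rpow (a t : ℝ) :
    ContinuousOn (fun s : ℝ => (1 + t - s) ^ (-a)) (Set.Icc 0 t) :=
  ContinuousOn.rpow_const (by fun_prop) fun s hs => Or.inl (by linarith [hs.2])

lemma setIntegral_one_add_rpow {t : ℝ} (ht : 0 ≤ t) (a : ℝ) :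
    ∫ s in Set.Icc (0 : ℝ) t, (1 + s) ^ (-a) = Gam a t := by
  rw [Gam, intervalIntegral.integral_of_le ht, integral_Icc_eq_integral_Ioc]

lemma setIntegral_one_add_sub_rpow {t : ℝ} (ht : 0 ≤ t) (a : ℝ) :
    ∫ s in Set.Icc (0 : ℝ) t, (1 + t - s) ^ (-a) = Gam a t := by
  rw [integral_Icc_eq_integral_Ioc, ← intervalIntegral.integral_of_le ht, Gam]
  have := intervalIntegral.integral_comp_sub_left (a := 0) (b := t)
    (fun s : ℝ => (1 + s) ^ (-a)) t
  simpa [add_sub_assoc] using this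

/-- Diffusive wave coupling: for `α, β > 0` and `D > 0` there are `C > 0` and `D₁ ≥ 16D`
such that `I^{α,β}(t,x;0,0,D,D₁)
  ≤ C ((1+t)^{-α} Γ_{β-3/2}(t) + (1+t)^{-β} Γ_{α-3/2}(t)) e^{-3|x|²/(2D₁(1+t))}`. -/
theorem diffusive_coupling_bound (α β D : ℝ) (hα : 0 < α) (hβ : 0 < β) (hD : 0 < D) :
    ∃ C > (0 : ℝ), ∃ D₁ ≥ 16 * D, ∀ t : ℝ, 0 ≤ t → ∀ x : E3,
      Ifun α β 0 0 D D₁ t x ≤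
        ENNReal.ofReal (C * ((1 + t) ^ (-α) * Gam (β - 3 / 2) t +
            (1 + t) ^ (-β) * Gam (α - 3 / 2) t) *
          Real.exp (-3 * ‖x‖ ^ 2 / (2 * D₁ * (1 + t)))) := by
  refine ⟨(2 ^ α + 2 ^ β) * (160 * π * D) ^ (3 / 2 : ℝ), by positivity, 64 * D, by linarith,
    fun t ht x => ?_⟩
  set K : ℝ := (160 * π * D) ^ (3 / 2 : ℝ)
  have hK0 : 0 ≤ K := by positivity
  set E : ℝ := exp (-3 * ‖x‖ ^ 2 / (2 * (64 * D) * (1 + t)))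
  have hE0 : 0 ≤ E := (exp_pos _).le
  have int1 : IntegrableOn (fun s : ℝ => (1 + t) ^ (-α) * (1 + s) ^ (-(β - 3 / 2)))
      (Set.Icc 0 t) := ((continuousOn_one_add_rpow _ t).integrableOn_Icc).const_mul _
  have int2 : IntegrableOn (fun s : ℝ => (1 + t) ^ (-β) * (1 + t - s) ^ (-(α - 3 / 2)))
      (Set.Icc 0 t) := ((continuousOn_one_add_sub_rpow _ t).integrableOn_Icc).const_mul _
  have hval : ∫ s in Set.Icc (0 : ℝ) t, (2 ^ α + 2 ^ β) * K * E *
      ((1 + t) ^ (-α) * (1 + s) ^ (-(β - 3 / 2)) +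
        (1 + t) ^ (-β) * (1 + t - s) ^ (-(α - 3 / 2))) =
      (2 ^ α + 2 ^ β) * K * ((1 + t) ^ (-α) * Gam (β - 3 / 2) t +
            (1 + t) ^ (-β) * Gam (α - 3 / 2) t) * E := by
    rw [integral_const_mul, integral_add int1 int2, integral_const_mul, integral_const_mul,
      setIntegral_one_add_rpow ht, setIntegral_one_add_sub_rpow ht]
    ring
  rw [← hval, ofReal_integral_eq_lintegral_ofReal]
  · refine setLIntegral_mono' measurableSet_Icc fun s hs => ?_
    have hA : 0 < 1 + t - s := by linarith [hs.2]
    have hB : 0 < 1 + s := by linarith [hs.1]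
    have hAB : 0 ≤ (1 + t - s) ^ (-α) * (1 + s) ^ (-β) := by positivity
    calc _ = ∫⁻ y : E3, ENNReal.ofReal ((1 + t - s) ^ (-α) * (1 + s) ^ (-β)) *
          ENNReal.ofReal (exp (-‖x - y‖ ^ 2 / (D * (1 + t - s))) *
            exp (-2 * ‖y‖ ^ 2 / (64 * D * (1 + s)))) := by
          refine lintegral_congr fun y => ?_
          rw [← ENNReal.ofReal_mul hAB]
          congr 1
          simp only [zero_mul, sub_zero]
          ring
      _ ≤ ENNReal.ofReal ((1 + t - s) ^ (-α) * (1 + s) ^ (-β)) *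
          ENNReal.ofReal (E * (K * (min (1 + t - s) (1 + s)) ^ (3 / 2 : ℝ))) := by
          rw [lintegral_const_mul' _ _ ENNReal.ofReal_ne_top]
          gcongr
          exact lintegral_coupled_gaussian_le hD hA hB (by linarith [hs.1]) (by linarith [hs.2]) x
      _ ≤ _ := by
          rw [← ENNReal.ofReal_mul hAB]
          apply ENNReal.ofReal_le_ofReal
          have := mul_le_mul_of_nonneg_left (rpow_mul_rpow_mul_min_le hα.le hβ.le hA hB
            (T := 1 + t) (by linarith) (by linarith)) (mul_nonneg hK0 hE0)
          linarith
  · exact (int1.add int2).const_mul _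
  · refine (ae_restrict_iff' measurableSet_Icc).2 (Filter.Eventually.of_forall fun s hs => ?_)
    have hA : 0 < 1 + t - s := by linarith [hs.2]
    have hB : 0 < 1 + s := by linarith [hs.1]
    have hT : 0 < 1 + t := by linarith
    simp only [Pi.zero_apply]
    positivity

end
end

section
/- Let α, D, λ > 0 and 0 < η < 2/3, and let D₂ > max{ (3D/(2 − 2√(3η/2)))·max{1, λ}², 6D/(1 − √(3η/2)) }. There exists a constant C > 0 such that for all t ≥ 0 and x ∈ ℝ³, ∫₀^t ∫_{ℝ³} e^{−(|x−y|+(t−s))/D} (1+s)^{−α} e^{−|y|²/(ηD₂(1+s))} dy ds ≤ C (1+t)^{−α} e^{−3|x|²/(2D₂(1+t))} + C e^{−3(|x|+t)/(2D₂)}. -/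
open MeasureTheory Real
open scoped ENNReal

noncomputable section

/-- Exponentials dominate powers: `(1 + v)^α ≤ max(1, α/δ)^α e^{δv}`. -/
theorem one_add_rpow_le_mul_exp {α δ v : ℝ} (hα : 0 < α) (hδ : 0 < δ) (hv : 0 ≤ v) :
    (1 + v) ^ α ≤ max 1 (α / δ) ^ α * Real.exp (δ * v) := by
  have hbase : 1 + v ≤ max 1 (α / δ) * Real.exp (δ / α * v) := by
    have h1 : (1 : ℝ) ≤ max 1 (α / δ) := le_max_left _ _
    have h2 : v ≤ max 1 (α / δ) * (δ / α * v) := by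
      calc v = α / δ * (δ / α * v) := by field_simp
        _ ≤ _ := by gcongr; exact le_max_right _ _
    calc 1 + v ≤ max 1 (α / δ) * (δ / α * v + 1) := by linarith
      _ ≤ _ := by gcongr; exact Real.add_one_le_exp _
  calc (1 + v) ^ α ≤ (max 1 (α / δ) * Real.exp (δ / α * v)) ^ α := by gcongr
    _ = _ := by
      rw [Real.mul_rpow (by positivity) (by positivity), ← Real.exp_mul]
      congr 2
      field_simp

/-- A power weight at time `s` is controlled by the one at time `t ≥ s`, up to `e^{δ(t-s)}`. -/
theorem one_add_rpow_neg_le_mul_exp {α δ s t : ℝ} (hα : 0 < α) (hδ : 0 < δ) (hs : 0 ≤ s)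
    (hst : s ≤ t) :
    (1 + s) ^ (-α) ≤ max 1 (α / δ) ^ α * Real.exp (δ * (t - s)) * (1 + t) ^ (-α) := by
  have hS : 0 < (1 + s) ^ α := by positivity
  have hT : 0 < (1 + t) ^ α := Real.rpow_pos_of_pos (by linarith) _
  rw [Real.rpow_neg (by linarith), Real.rpow_neg (by linarith), ← div_eq_mul_inv,
    le_div_iff₀ hT, inv_mul_le_iff₀ hS]
  calc (1 + t) ^ α ≤ ((1 + s) * (1 + (t - s))) ^ α :=
        Real.rpow_le_rpow (by linarith) (by nlinarith) hα.le
    _ = (1 + s) ^ α * (1 + (t - s)) ^ α := Real.mul_rpow (by linarith) (by linarith)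
    _ ≤ _ := by
      gcongr
      exact one_add_rpow_le_mul_exp hα hδ (by linarith)

theorem lintegral_exp_neg_mul_norm_lt_top_s12 {E : Type*} [NormedAddCommGroup E] [NormedSpace ℝ E]
    [FiniteDimensional ℝ E] [MeasurableSpace E] [BorelSpace E] (μ : Measure E)
    [μ.IsAddHaarMeasure] {ε : ℝ} (hε : 0 < ε) :
    ∫⁻ y, ENNReal.ofReal (Real.exp (-(ε * ‖y‖))) ∂μ < ∞ := by
  set r : ℝ := Module.finrank ℝ E + 1
  have hr : 0 < r := by positivity
  calc ∫⁻ y, ENNReal.ofReal (Real.exp (-(ε * ‖y‖))) ∂μ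
      ≤ ∫⁻ y, ENNReal.ofReal (max 1 (r / ε) ^ r) * ENNReal.ofReal ((1 + ‖y‖) ^ (-r)) ∂μ := by
        refine lintegral_mono fun y => ?_
        rw [← ENNReal.ofReal_mul (by positivity)]
        refine ENNReal.ofReal_le_ofReal ?_
        rw [Real.exp_neg, Real.rpow_neg (by positivity), ← div_eq_mul_inv,
          le_div_iff₀ (by positivity), inv_mul_le_iff₀ (Real.exp_pos _), mul_comm]
        exact one_add_rpow_le_mul_exp hr hε (norm_nonneg y)
    _ = ENNReal.ofReal (max 1 (r / ε) ^ r) * ∫⁻ y, ENNReal.ofReal ((1 + ‖y‖) ^ (-r)) ∂μ :=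
        lintegral_const_mul' _ _ ENNReal.ofReal_ne_top
    _ < ∞ := ENNReal.mul_lt_top ENNReal.ofReal_lt_top
        (finite_integral_one_add_norm (by simp [r]))

/-- Either `|y| ≥ σ|x|` and the Gaussian already has the rate `b|x|²/(1+t)`, or `|x - y|` is
comparable to `|x|` and the exponential wins. -/
theorem exp_neg_mul_gaussian_le {a b σ ε s t r ρ d : ℝ} (hb : 0 < b) (hσ0 : 0 < σ) (hσ1 : σ < 1)
    (hε : (a - ε) * (1 - σ) = 4 * b) (hs : 0 ≤ s) (hst : s ≤ t) (hr : 0 ≤ r)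
    (hd0 : 0 ≤ d) (hd : r ≤ ρ + d) :
    Real.exp (-(a * (d + (t - s)))) * Real.exp (-(b * ρ ^ 2 / (σ ^ 2 * (1 + s)))) ≤
      Real.exp (-(ε * (d + (t - s)))) *
        (Real.exp (-(b * r ^ 2 / (1 + t))) + Real.exp (-(b * (r + t)))) := by
  have haε : 4 * b ≤ a - ε := by nlinarith
  have hT : 0 < 1 + t := by linarith
  have hG : 0 ≤ b * ρ ^ 2 / (σ ^ 2 * (1 + s)) := by positivity
  have hmin : b * r ^ 2 / (1 + t) ≤ (a - ε) * (d + (t - s)) + b * ρ ^ 2 / (σ ^ 2 * (1 + s)) ∨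
      b * (r + t) ≤ (a - ε) * (d + (t - s)) + b * ρ ^ 2 / (σ ^ 2 * (1 + s)) := by
    rcases le_total (σ * r) ρ with h | h
    · left
      have h1 : b * r ^ 2 / (1 + t) ≤ b * ρ ^ 2 / (σ ^ 2 * (1 + s)) := by
        calc b * r ^ 2 / (1 + t) ≤ b * r ^ 2 / (1 + s) := by gcongr
          _ = b * (σ * r) ^ 2 / (σ ^ 2 * (1 + s)) := by field_simp
          _ ≤ _ := by gcongr
      have h2 : 0 ≤ (a - ε) * (d + (t - s)) := mul_nonneg (by linarith) (by linarith)
      linarith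
    · have h1 : 4 * b * r ≤ (a - ε) * (d + (t - s)) := by
        calc 4 * b * r = (a - ε) * ((1 - σ) * r) := by rw [← hε]; ring
          _ ≤ _ := mul_le_mul_of_nonneg_left (by linarith) (by linarith)
      rcases le_total t (3 * r) with h3 | h3
      · right
        nlinarith
      · left
        have h4 : b * r ^ 2 / (1 + t) ≤ b * r := by
          rw [div_le_iff₀ hT, sq, ← mul_assoc]
          gcongr
          linarith
        nlinarith [mul_nonneg hb.le hr]
  have hsplit : Real.exp (-(a * (d + (t - s)))) * Real.exp (-(b * ρ ^ 2 / (σ ^ 2 * (1 + s)))) =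
      Real.exp (-(ε * (d + (t - s)))) *
        Real.exp (-((a - ε) * (d + (t - s)) + b * ρ ^ 2 / (σ ^ 2 * (1 + s)))) := by
    rw [← Real.exp_add, ← Real.exp_add]
    congr 1
    ring
  rw [hsplit]
  gcongr
  rcases hmin with h | h
  · exact (Real.exp_le_exp.2 (neg_le_neg h)).trans (le_add_of_nonneg_right (Real.exp_pos _).le)
  · exact (Real.exp_le_exp.2 (neg_le_neg h)).trans (le_add_of_nonneg_left (Real.exp_pos _).le)

/-- Coupling of the exponentially localized wave with a diffusive Gaussian: for
`α, D, λ > 0`, `0 < η < 2/3` and `D₂ > max{3D max{1,λ}²/(2-2√(3η/2)), 6D/(1-√(3η/2))}`,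
there is `C > 0` such that for all `t ≥ 0`, `x ∈ ℝ³`,
`∫₀ᵗ ∫ e^{-(|x-y|+(t-s))/D} (1+s)^{-α} e^{-|y|²/(ηD₂(1+s))} dy ds
  ≤ C (1+t)^{-α} e^{-3|x|²/(2D₂(1+t))} + C e^{-3(|x|+t)/(2D₂)}`. -/
theorem singular_diffusive_coupling (α D lam η D₂ : ℝ) (hα : 0 < α) (hD : 0 < D)
    (hlam : 0 < lam) (hη0 : 0 < η) (hη : η < 2 / 3)
    (hD₂ : max (3 * D / (2 - 2 * Real.sqrt (3 * η / 2)) * max 1 lam ^ 2)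
        (6 * D / (1 - Real.sqrt (3 * η / 2))) < D₂) :
    ∃ C > (0 : ℝ), ∀ t : ℝ, 0 ≤ t → ∀ x : E3,
      (∫⁻ s in Set.Icc (0 : ℝ) t, ∫⁻ y : E3,
          ENNReal.ofReal (Real.exp (-(‖x - y‖ + (t - s)) / D) * (1 + s) ^ (-α) *
            Real.exp (-‖y‖ ^ 2 / (η * D₂ * (1 + s))))) ≤
        ENNReal.ofReal (C * (1 + t) ^ (-α) * Real.exp (-3 * ‖x‖ ^ 2 / (2 * D₂ * (1 + t))) +
          C * Real.exp (-3 * (‖x‖ + t) / (2 * D₂))) := by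
  set σ := Real.sqrt (3 * η / 2)
  have hσ0 : 0 < σ := Real.sqrt_pos.2 (by positivity)
  have hσsq : σ ^ 2 = 3 * η / 2 := Real.sq_sqrt (by positivity)
  have hσ1 : σ < 1 := by nlinarith
  have hD₂' : 6 * D / (1 - σ) < D₂ := (le_max_right _ _).trans_lt hD₂
  have hσ' : 0 < 1 - σ := by linarith
  have hD₂0 : 0 < D₂ := lt_of_le_of_lt (by positivity) hD₂'
  set b := 3 / (2 * D₂) with hb_def
  have hb : 0 < b := by positivity
  set ε := 1 / D - 4 * b / (1 - σ) with hε_def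
  have hε : 0 < ε := by
    rw [hε_def, sub_pos, hb_def, div_lt_div_iff₀ hσ' hD]
    rw [div_lt_iff₀ hσ'] at hD₂'
    have : 4 * (3 / (2 * D₂)) * D = 6 * D / D₂ := by field_simp; norm_num
    rw [this, div_lt_iff₀ hD₂0]
    linarith
  have hεσ : (1 / D - ε) * (1 - σ) = 4 * b := by
    rw [hε_def, sub_sub_cancel, div_mul_cancel₀ _ hσ'.ne']
  set M := max 1 (α / (ε / 2)) ^ α
  have hM : 1 ≤ M := Real.one_le_rpow (le_max_left _ _) hα.le
  set I := ∫⁻ y : E3, ENNReal.ofReal (Real.exp (-(ε * ‖y‖)))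
  set J := ∫⁻ s : ℝ, ENNReal.ofReal (Real.exp (-(ε / 2 * ‖s‖)))
  have hI : I ≠ ∞ := (lintegral_exp_neg_mul_norm_lt_top_s12 volume hε).ne
  have hJ : J ≠ ∞ := (lintegral_exp_neg_mul_norm_lt_top_s12 volume (half_pos hε)).ne
  refine ⟨M * ((I * J).toReal + 1), by positivity, fun t ht x => ?_⟩
  set A := (1 + t) ^ (-α) * Real.exp (-(b * ‖x‖ ^ 2 / (1 + t))) + Real.exp (-(b * (‖x‖ + t)))
  have hA : 0 ≤ A := by positivity
  have hpoint : ∀ s ∈ Set.Icc (0 : ℝ) t, ∀ y : E3,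
      Real.exp (-(‖x - y‖ + (t - s)) / D) * (1 + s) ^ (-α) *
        Real.exp (-‖y‖ ^ 2 / (η * D₂ * (1 + s))) ≤
      M * A * Real.exp (-(ε / 2 * ‖t - s‖)) * Real.exp (-(ε * ‖x - y‖)) := by
    rintro s ⟨hs, hst⟩ y
    have hd : ‖x‖ ≤ ‖y‖ + ‖x - y‖ := norm_le_norm_add_norm_sub' x y
    have hexp := exp_neg_mul_gaussian_le (a := 1 / D) hb hσ0 hσ1 hεσ hs hst (norm_nonneg x)
      (norm_nonneg (x - y)) hd
    have hweight := one_add_rpow_neg_le_mul_exp hα (half_pos hε) hs hst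
    have hS1 : (1 + s) ^ (-α) ≤ 1 :=
      Real.rpow_le_one_of_one_le_of_nonpos (by linarith) (by linarith)
    have hu : ‖t - s‖ = t - s := by rw [Real.norm_eq_abs, abs_of_nonneg (by linarith)]
    have hgauss : -‖y‖ ^ 2 / (η * D₂ * (1 + s)) = -(b * ‖y‖ ^ 2 / (σ ^ 2 * (1 + s))) := by
      rw [hσsq, hb_def]
      field_simp
    have hwave : -(‖x - y‖ + (t - s)) / D = -(1 / D * (‖x - y‖ + (t - s))) := by ring
    have hE : 1 ≤ Real.exp (ε / 2 * (t - s)) :=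
      Real.one_le_exp (mul_nonneg (half_pos hε).le (by linarith))
    rw [hgauss, hwave, hu]
    set G := Real.exp (-(b * ‖x‖ ^ 2 / (1 + t)))
    set H := Real.exp (-(b * (‖x‖ + t)))
    calc _ = (1 + s) ^ (-α) * (Real.exp (-(1 / D * (‖x - y‖ + (t - s)))) *
          Real.exp (-(b * ‖y‖ ^ 2 / (σ ^ 2 * (1 + s))))) := by ring
      _ ≤ (1 + s) ^ (-α) * (Real.exp (-(ε * (‖x - y‖ + (t - s)))) * (G + H)) := by gcongr
      _ = Real.exp (-(ε * (‖x - y‖ + (t - s)))) *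
          ((1 + s) ^ (-α) * G + (1 + s) ^ (-α) * H) := by ring
      _ ≤ Real.exp (-(ε * (‖x - y‖ + (t - s)))) *
          (M * Real.exp (ε / 2 * (t - s)) * (1 + t) ^ (-α) * G +
            M * Real.exp (ε / 2 * (t - s)) * H) := by
        gcongr
        exact hS1.trans (one_le_mul_of_one_le_of_one_le hM hE)
      _ = M * A * (Real.exp (-(ε * (‖x - y‖ + (t - s)))) * Real.exp (ε / 2 * (t - s))) := by ring
      _ = _ := by
        rw [mul_assoc (M * A), ← Real.exp_add, ← Real.exp_add]
        congr 2
        ring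
  calc _ ≤ ∫⁻ s in Set.Icc (0 : ℝ) t,
        ENNReal.ofReal (M * A) * ENNReal.ofReal (Real.exp (-(ε / 2 * ‖t - s‖))) * I := by
        refine setLIntegral_mono' measurableSet_Icc fun s hs => ?_
        calc _ ≤ ∫⁻ y : E3, ENNReal.ofReal (M * A * Real.exp (-(ε / 2 * ‖t - s‖))) *
              ENNReal.ofReal (Real.exp (-(ε * ‖x - y‖))) := by
              refine lintegral_mono fun y => ?_
              rw [← ENNReal.ofReal_mul (by positivity)]
              exact ENNReal.ofReal_le_ofReal (hpoint s hs y)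
          _ = _ := by
              rw [lintegral_const_mul' _ _ ENNReal.ofReal_ne_top,
                lintegral_sub_left_eq_self
                  (fun y : E3 => ENNReal.ofReal (Real.exp (-(ε * ‖y‖)))) x,
                ENNReal.ofReal_mul (by positivity)]
    _ ≤ ∫⁻ s : ℝ, ENNReal.ofReal (M * A) *
          ENNReal.ofReal (Real.exp (-(ε / 2 * ‖t - s‖))) * I := setLIntegral_le_lintegral _ _
    _ = ENNReal.ofReal (M * A) * (I * J) := by
        rw [lintegral_mul_const' _ _ hI, lintegral_const_mul' _ _ ENNReal.ofReal_ne_top,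
          lintegral_sub_left_eq_self
            (fun s : ℝ => ENNReal.ofReal (Real.exp (-(ε / 2 * ‖s‖)))) t, mul_assoc, mul_comm J I]
    _ = ENNReal.ofReal (M * A * (I * J).toReal) := by
        rw [ENNReal.ofReal_mul (p := M * A) (by positivity), ENNReal.ofReal_toReal (ENNReal.mul_ne_top hI hJ)]
    _ ≤ _ := by
        refine ENNReal.ofReal_le_ofReal ?_
        have h1 : -3 * ‖x‖ ^ 2 / (2 * D₂ * (1 + t)) = -(b * ‖x‖ ^ 2 / (1 + t)) := by
          rw [hb_def]
          field_simp
        have h2 : -3 * (‖x‖ + t) / (2 * D₂) = -(b * (‖x‖ + t)) := by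
          rw [hb_def]
          field_simp
        rw [h1, h2]
        calc M * A * (I * J).toReal ≤ M * A * ((I * J).toReal + 1) := by gcongr; linarith
          _ = _ := by ring

end
end

section
/- Let α, D, λ > 0, k > 3/2 and 0 < η < 2/3, and let D₂ > max{ (3D/(2 − 2√(3η/2)))·max{1, λ}², 6D/(1 − √(3η/2)) }. There exists a constant C > 0 such that for all t ≥ 0 and x ∈ ℝ³, both M := ∫₀^t ∫_{ℝ³} e^{−(|x−y|+(t−s))/D} (1+s)^{−α} e^{−(|y|−λs)²/(ηD₂(1+s))} dy ds and N := ∫₀^t ∫_{{|y| ≤ λs}} e^{−(|x−y|+(t−s))/D} (1+s)^{−α} B_k(s, |y|−λs) dy ds satisfy M, N ≤ C (1+t)^{−α} (e^{−3(|x|−λt)²/(2D₂(1+t))} + e^{−3|x|²/(2D₂(1+t))}) + C e^{−3(|x|+t)/(2D₂)} + C (1+t)^{−α} B_k(t, |x|−λt) 1_{{|x| ≤ λt}}. -/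
open MeasureTheory Real
open scoped ENNReal

noncomputable section

theorem one_add_rpow_le_mul_exp_s14 {β c : ℝ} (hβ : 0 < β) (hc : 0 < c) :
    ∃ K : ℝ, 1 ≤ K ∧ ∀ u : ℝ, 0 ≤ u → (1 + u) ^ β ≤ K * Real.exp (c * u) := by
  refine ⟨max 1 (Real.exp (c - β * Real.log (c / β))), le_max_left _ _, fun u hu => ?_⟩
  have h1 : (0 : ℝ) < 1 + u := by linarith
  have h2 : 0 < c / β := div_pos hc hβ
  have h3 : β * Real.log (1 + u) ≤ c - β * Real.log (c / β) + c * u := by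
    have h4 := Real.log_le_sub_one_of_pos (mul_pos h1 h2)
    rw [Real.log_mul h1.ne' h2.ne'] at h4
    have h5 := mul_le_mul_of_nonneg_left h4 hβ.le
    have h6 : β * ((1 + u) * (c / β) - 1) = c * (1 + u) - β := by field_simp
    rw [h6] at h5
    linarith
  calc (1 + u) ^ β = Real.exp (β * Real.log (1 + u)) := by
        rw [Real.rpow_def_of_pos h1, mul_comm]
    _ ≤ Real.exp (c - β * Real.log (c / β)) * Real.exp (c * u) := by
        rw [← Real.exp_add]; exact Real.exp_le_exp.2 h3
    _ ≤ _ := by gcongr; exact le_max_right _ _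

theorem lintegral_exp_neg_mul_norm_sub {E : Type*} [NormedAddCommGroup E] [NormedSpace ℝ E]
    [FiniteDimensional ℝ E] [MeasurableSpace E] [BorelSpace E] (μ : Measure E)
    [μ.IsAddHaarMeasure] {c : ℝ} (hc : 0 < c) :
    ∃ A : ℝ, 0 ≤ A ∧
      ∀ x : E, ∫⁻ y, ENNReal.ofReal (Real.exp (-(c * ‖x - y‖))) ∂μ = ENNReal.ofReal A := by
  set n : ℝ := Module.finrank ℝ E + 1
  have hn : 0 < n := by positivity
  obtain ⟨K, hK1, hK⟩ := one_add_rpow_le_mul_exp_s14 hn hc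
  have hfin : ∫⁻ y, ENNReal.ofReal (Real.exp (-(c * ‖y‖))) ∂μ ≠ ⊤ := by
    have hint : Integrable (fun y : E => K * (1 + ‖y‖) ^ (-n)) μ :=
      (integrable_one_add_norm (by simp [n])).const_mul K
    refine ne_top_of_le_ne_top hint.lintegral_lt_top.ne
      (lintegral_mono fun y => ENNReal.ofReal_le_ofReal ?_)
    have hy := norm_nonneg y
    have hp : 0 < (1 + ‖y‖) ^ n := by positivity
    rw [Real.exp_neg, Real.rpow_neg (by positivity), ← div_eq_mul_inv, inv_eq_one_div,
      div_le_div_iff₀ (Real.exp_pos _) hp]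
    linarith [hK _ hy]
  refine ⟨(∫⁻ y, ENNReal.ofReal (Real.exp (-(c * ‖y‖))) ∂μ).toReal, ENNReal.toReal_nonneg,
    fun x => ?_⟩
  rw [lintegral_sub_left_eq_self (μ := μ)
    (fun y => ENNReal.ofReal (Real.exp (-(c * ‖y‖)))) x, ENNReal.ofReal_toReal hfin]

theorem one_add_rpow_neg_le {α s t L : ℝ} (hα : 0 < α) (hs : 0 ≤ s) (hst : s ≤ t)
    (hL : t - s ≤ L) : (1 + s) ^ (-α) ≤ (1 + t) ^ (-α) * (1 + L) ^ α := by
  have h1 : 1 + t ≤ (1 + s) * (1 + L) := by nlinarith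
  have h2 : (1 + t) ^ α ≤ (1 + s) ^ α * (1 + L) ^ α := by
    rw [← Real.mul_rpow (by linarith) (by linarith)]
    exact Real.rpow_le_rpow (by linarith) h1 hα.le
  have hps : 0 < (1 + s) ^ α := Real.rpow_pos_of_pos (by linarith) _
  have hpt : 0 < (1 + t) ^ α := Real.rpow_pos_of_pos (by linarith) _
  rw [Real.rpow_neg (by linarith), Real.rpow_neg (by linarith), inv_mul_eq_div,
    le_div_iff₀ hpt, inv_mul_le_iff₀ hps]
  exact h2

theorem Bprof_le_one_s14 {k s w : ℝ} (hk : 0 ≤ k) (hs : 0 ≤ s) : Bprof k s w ≤ 1 := by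
  apply Real.rpow_le_one_of_one_le_of_nonpos
  · have : 0 ≤ w ^ 2 / (1 + s) := by positivity
    linarith
  · linarith

theorem Bprof_nonneg_s14 {k s w : ℝ} (hs : 0 ≤ s) : 0 ≤ Bprof k s w := by
  unfold Bprof; positivity

theorem Bprof_le_Bprof_mul {k m s t z w L : ℝ} (hk : 0 < k) (hm : 1 ≤ m) (hs : 0 ≤ s)
    (hst : s ≤ t) (hL : 0 ≤ L) (h : |z - w| ≤ m * L) :
    Bprof k s w ≤ (2 * m ^ 2) ^ k * (Bprof k t z * (1 + L) ^ (2 * k)) := by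
  have ht : 0 ≤ t := hs.trans hst
  have hz : z ^ 2 ≤ 2 * w ^ 2 + 2 * (m * L) ^ 2 := by
    have := sq_le_sq' (by linarith [abs_nonneg (z - w)] : -(m * L) ≤ |z - w|) h
    rw [sq_abs] at this
    nlinarith [sq_nonneg (z - 2 * w)]
  have hbase : 1 + z ^ 2 / (1 + t) ≤ (1 + w ^ 2 / (1 + s)) * (2 * m ^ 2 * (1 + L) ^ 2) := by
    have hb : z ^ 2 / (1 + t) ≤ 2 * (w ^ 2 / (1 + s)) + 2 * (m * L) ^ 2 := by
      calc z ^ 2 / (1 + t) ≤ (2 * w ^ 2 + 2 * (m * L) ^ 2) / (1 + t) := by gcongr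
        _ = 2 * (w ^ 2 / (1 + t)) + 2 * (m * L) ^ 2 / (1 + t) := by ring
        _ ≤ 2 * (w ^ 2 / (1 + s)) + 2 * (m * L) ^ 2 := by
          gcongr
          exact div_le_self (by positivity) (by linarith)
    have hq : 0 ≤ w ^ 2 / (1 + s) := by positivity
    have hm2 : 1 + (m * L) ^ 2 ≤ m ^ 2 * (1 + L) ^ 2 := by nlinarith
    calc 1 + z ^ 2 / (1 + t) ≤ (1 + w ^ 2 / (1 + s)) * (2 * (1 + (m * L) ^ 2)) := by
          nlinarith [mul_nonneg hq (sq_nonneg (m * L)), sq_nonneg (m * L)]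
      _ ≤ (1 + w ^ 2 / (1 + s)) * (2 * (m ^ 2 * (1 + L) ^ 2)) := by gcongr
      _ = _ := by ring
  have hpow := Real.rpow_le_rpow (by positivity) hbase hk.le
  rw [Real.mul_rpow (by positivity) (by positivity),
    Real.mul_rpow (by positivity) (by positivity), ← Real.rpow_natCast (1 + L) 2,
    ← Real.rpow_mul (by linarith)] at hpow
  push_cast at hpow
  unfold Bprof
  have hpw : 0 < (1 + w ^ 2 / (1 + s)) ^ k := by positivity
  have hpz : 0 < (1 + z ^ 2 / (1 + t)) ^ k := by positivity
  rw [Real.rpow_neg (by positivity), Real.rpow_neg (by positivity), inv_mul_eq_div,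
    ← mul_div_assoc, le_div_iff₀ hpz, inv_mul_le_iff₀ hpw]
  exact hpow

/-- Far from the Huygens cone at time `s`, the exponential localization alone dominates either
the Gaussian around the cone at time `t` or the exponential space-time decay. -/
theorem gaussian_or_exp_exponent_le {a D₂ q m lam r t L : ℝ} (ha : 0 < a) (hD₂ : 0 < D₂)
    (hm : 1 ≤ m) (hml : lam ≤ m) (hr : 0 ≤ r) (ht : 0 ≤ t)
    (h1 : 3 * m ^ 2 ≤ 2 * D₂ * a * (1 - q)) (h2 : 6 ≤ D₂ * a * (1 - q))
    (H1 : (1 - q) * |r - lam * t| ≤ m * L)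
    (H2 : 0 < r - lam * t → (1 - q) * (r - lam * t) ≤ L) :
    3 * (r - lam * t) ^ 2 / (2 * D₂ * (1 + t)) ≤ a * L ∨ 3 * (r + t) / (2 * D₂) ≤ a * L := by
  set z := r - lam * t
  have hDa : 0 < D₂ * a := mul_pos hD₂ ha
  have hz0 := abs_nonneg z
  have hm0 : 0 < m := by linarith
  by_cases hc : |z| ≤ m * (1 + t)
  · left
    have e1 : 3 * m * |z| ≤ 2 * D₂ * a * L := by
      have f1 := mul_le_mul_of_nonneg_left H1 (by positivity : 0 ≤ 2 * (D₂ * a))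
      have f2 := mul_le_mul_of_nonneg_right h1 hz0
      refine le_of_mul_le_mul_left ?_ hm0
      nlinarith
    rw [div_le_iff₀ (by positivity), ← sq_abs]
    have f3 := mul_le_mul_of_nonneg_right e1 (by linarith : 0 ≤ 1 + t)
    have f4 := mul_le_mul_of_nonneg_right hc hz0
    nlinarith
  · right
    push Not at hc
    have hmt : lam * t ≤ m * t := by gcongr
    have hzp : 0 < z := by
      by_contra hn
      rw [abs_of_nonpos (not_lt.1 hn)] at hc
      nlinarith
    rw [abs_of_pos hzp] at hc
    have g1 := mul_le_mul_of_nonneg_left (H2 hzp) hDa.le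
    have g2 := mul_le_mul_of_nonneg_right h2 hzp.le
    rw [div_le_iff₀ (by positivity)]
    have g3 : 1 * t ≤ m * t := by gcongr
    have g4 : r + t ≤ 4 * z := by nlinarith
    nlinarith

section Pointwise

variable {α lam k η D₂ a c m K s t r ρ d L : ℝ}

/-- The right-hand side of the coupling estimate with unit constant. -/
def couplingProfile (α lam k D₂ t r : ℝ) : ℝ :=
  (1 + t) ^ (-α) * (Real.exp (-3 * (r - lam * t) ^ 2 / (2 * D₂ * (1 + t))) +
      Real.exp (-3 * r ^ 2 / (2 * D₂ * (1 + t)))) +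
    Real.exp (-3 * (r + t) / (2 * D₂)) +
    (1 + t) ^ (-α) * (if r ≤ lam * t then Bprof k t (r - lam * t) else 0)

theorem gaussian_le_couplingProfile (ht : 0 ≤ t) :
    (1 + t) ^ (-α) * Real.exp (-(3 * (r - lam * t) ^ 2 / (2 * D₂ * (1 + t)))) ≤
      couplingProfile α lam k D₂ t r := by
  have hB : 0 ≤ (if r ≤ lam * t then Bprof k t (r - lam * t) else 0) := by
    split_ifs
    exacts [Bprof_nonneg_s14 ht, le_rfl]
  have h0 : 0 ≤ (1 + t) ^ (-α) * Real.exp (-3 * r ^ 2 / (2 * D₂ * (1 + t))) := by positivity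
  have h1 := Real.exp_pos (-3 * (r + t) / (2 * D₂))
  have h2 : 0 ≤ (1 + t) ^ (-α) * (if r ≤ lam * t then Bprof k t (r - lam * t) else 0) := by
    positivity
  unfold couplingProfile
  rw [mul_add ((1 + t) ^ (-α)), ← neg_div, ← neg_mul]
  linarith

theorem exp_le_couplingProfile (ht : 0 ≤ t) :
    Real.exp (-(3 * (r + t) / (2 * D₂))) ≤ couplingProfile α lam k D₂ t r := by
  have hB : 0 ≤ (if r ≤ lam * t then Bprof k t (r - lam * t) else 0) := by
    split_ifs
    exacts [Bprof_nonneg_s14 ht, le_rfl]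
  have h2 : 0 ≤ (1 + t) ^ (-α) * (if r ≤ lam * t then Bprof k t (r - lam * t) else 0) := by
    positivity
  have h0 : 0 ≤ (1 + t) ^ (-α) * (Real.exp (-3 * (r - lam * t) ^ 2 / (2 * D₂ * (1 + t))) +
      Real.exp (-3 * r ^ 2 / (2 * D₂ * (1 + t)))) := by positivity
  unfold couplingProfile
  rw [← neg_div, ← neg_mul]
  linarith

theorem Bprof_le_couplingProfile (ht : 0 ≤ t) (hr : r ≤ lam * t) :
    (1 + t) ^ (-α) * Bprof k t (r - lam * t) ≤ couplingProfile α lam k D₂ t r := by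
  have h0 : 0 ≤ (1 + t) ^ (-α) * (Real.exp (-3 * (r - lam * t) ^ 2 / (2 * D₂ * (1 + t))) +
      Real.exp (-3 * r ^ 2 / (2 * D₂ * (1 + t)))) := by positivity
  have h1 := Real.exp_pos (-3 * (r + t) / (2 * D₂))
  unfold couplingProfile
  rw [if_pos hr]
  linarith

theorem couplingProfile_nonneg (ht : 0 ≤ t) : 0 ≤ couplingProfile α lam k D₂ t r :=
  (Real.exp_pos _).le.trans (exp_le_couplingProfile ht)

theorem exp_mul_rpow_le_of_gaussian_or_exp (hα : 0 < α) (hK1 : 1 ≤ K)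
    (hc : 0 < c) (hs : 0 ≤ s) (hst : s ≤ t) (hL : t - s ≤ L)
    (hK : (1 + L) ^ α ≤ K * Real.exp (c * L))
    (h : 3 * (r - lam * t) ^ 2 / (2 * D₂ * (1 + t)) ≤ a * L ∨ 3 * (r + t) / (2 * D₂) ≤ a * L) :
    Real.exp (-((a + 2 * c) * L)) * (1 + s) ^ (-α) ≤
      K * couplingProfile α lam k D₂ t r * Real.exp (-(c * L)) := by
  have ht : 0 ≤ t := hs.trans hst
  have hL0 : 0 ≤ L := by linarith
  have hsplit : Real.exp (-((a + 2 * c) * L)) =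
      Real.exp (-(a * L)) * Real.exp (-(c * L)) * Real.exp (-(c * L)) := by
    rw [← Real.exp_add, ← Real.exp_add]; ring_nf
  have hcancel : Real.exp (-(c * L)) * Real.exp (c * L) = 1 := by
    rw [← Real.exp_add]; simp
  rcases h with h | h
  · calc _ ≤ Real.exp (-(3 * (r - lam * t) ^ 2 / (2 * D₂ * (1 + t)))) * Real.exp (-(c * L)) *
          Real.exp (-(c * L)) * ((1 + t) ^ (-α) * (K * Real.exp (c * L))) := by
          rw [hsplit]
          gcongr
          exact (one_add_rpow_neg_le hα hs hst hL).trans (by gcongr)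
      _ = K * ((1 + t) ^ (-α) * Real.exp (-(3 * (r - lam * t) ^ 2 / (2 * D₂ * (1 + t))))) *
          Real.exp (-(c * L)) * (Real.exp (-(c * L)) * Real.exp (c * L)) := by ring
      _ ≤ _ := by
          rw [hcancel, mul_one]
          gcongr
          exact gaussian_le_couplingProfile ht
  · calc _ ≤ Real.exp (-(3 * (r + t) / (2 * D₂))) * 1 * Real.exp (-(c * L)) * 1 := by
          rw [hsplit]
          gcongr
          · exact Real.exp_le_one_iff.2 (by nlinarith)
          · exact Real.rpow_le_one_of_one_le_of_nonpos (by linarith) (by linarith)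
      _ = 1 * Real.exp (-(3 * (r + t) / (2 * D₂))) * Real.exp (-(c * L)) := by ring
      _ ≤ _ := by
          gcongr
          exact exp_le_couplingProfile ht

theorem exp_mul_rpow_mul_gaussian_le (hα : 0 < α) (hη0 : 0 < η) (hη : η < 2 / 3)
    (hD₂ : 0 < D₂) (ha : 0 < a) (hc : 0 < c) (hK1 : 1 ≤ K)
    (hm : 1 ≤ m) (hml : lam ≤ m) (hlam : 0 < lam) (hs : 0 ≤ s) (hst : s ≤ t) (hr : 0 ≤ r)
    (hd : |r - ρ| ≤ d) (hLd : L = d + (t - s))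
    (h1 : 3 * m ^ 2 ≤ 2 * D₂ * a * (1 - Real.sqrt (3 * η / 2)))
    (h2 : 6 ≤ D₂ * a * (1 - Real.sqrt (3 * η / 2)))
    (hK : (1 + L) ^ α ≤ K * Real.exp (c * L)) :
    Real.exp (-((a + 2 * c) * L)) * (1 + s) ^ (-α) *
        Real.exp (-(ρ - lam * s) ^ 2 / (η * D₂ * (1 + s))) ≤
      K * couplingProfile α lam k D₂ t r * Real.exp (-(c * L)) := by
  set q := Real.sqrt (3 * η / 2)
  have hq0 : 0 ≤ q := Real.sqrt_nonneg _
  have hqq : q ^ 2 = 3 * η / 2 := Real.sq_sqrt (by positivity)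
  have ht : 0 ≤ t := hs.trans hst
  have hd0 : 0 ≤ d := (abs_nonneg _).trans hd
  have hL : t - s ≤ L := by linarith
  have hL0 : 0 ≤ L := by linarith
  have hG : Real.exp (-(ρ - lam * s) ^ 2 / (η * D₂ * (1 + s))) ≤ 1 := by
    rw [Real.exp_le_one_iff, neg_div, neg_nonpos]
    positivity
  by_cases hw : |ρ - lam * s| ≤ q * |r - lam * t|
  · have hz : |r - lam * t| ≤ |ρ - lam * s| + m * L := by
      have e : r - lam * t = (ρ - lam * s) + ((r - ρ) - lam * (t - s)) := by ring
      have e2 : |(r - ρ) - lam * (t - s)| ≤ m * L := by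
        refine (abs_sub _ _).trans ?_
        rw [abs_of_nonneg (by nlinarith : 0 ≤ lam * (t - s))]
        nlinarith
      calc |r - lam * t| = |(ρ - lam * s) + ((r - ρ) - lam * (t - s))| := by rw [← e]
        _ ≤ _ := (abs_add_le _ _).trans (by gcongr)
    have key := gaussian_or_exp_exponent_le (L := L) ha hD₂ hm hml hr ht h1 h2 (by linarith)
      (fun hzp => by
        rw [abs_of_pos hzp] at hw
        have := le_abs_self (ρ - lam * s)
        have := le_abs_self (r - ρ)
        nlinarith)
    refine le_trans ?_ (exp_mul_rpow_le_of_gaussian_or_exp hα hK1 hc hs hst hL hK key)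
    exact mul_le_of_le_one_right (by positivity) hG
  · push Not at hw
    have hw2 : 3 * η / 2 * (r - lam * t) ^ 2 ≤ (ρ - lam * s) ^ 2 := by
      rw [← hqq, ← sq_abs (r - _), ← sq_abs (ρ - _), ← mul_pow]
      gcongr
    have hexp : Real.exp (-(ρ - lam * s) ^ 2 / (η * D₂ * (1 + s))) ≤
        Real.exp (-(3 * (r - lam * t) ^ 2 / (2 * D₂ * (1 + t)))) := by
      rw [neg_div, Real.exp_le_exp, neg_le_neg_iff]
      calc 3 * (r - lam * t) ^ 2 / (2 * D₂ * (1 + t))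
          = 3 * η / 2 * (r - lam * t) ^ 2 / (η * D₂ * (1 + t)) := by field_simp
        _ ≤ _ := by gcongr
    have hcancel : Real.exp (-(2 * c * L)) * Real.exp (c * L) = Real.exp (-(c * L)) := by
      rw [← Real.exp_add]; ring_nf
    calc _ ≤ Real.exp (-(2 * c * L)) * ((1 + t) ^ (-α) * (K * Real.exp (c * L))) *
          Real.exp (-(3 * (r - lam * t) ^ 2 / (2 * D₂ * (1 + t)))) := by
          gcongr
          · linarith
          · exact (one_add_rpow_neg_le hα hs hst hL).trans (by gcongr)
      _ = K * ((1 + t) ^ (-α) * Real.exp (-(3 * (r - lam * t) ^ 2 / (2 * D₂ * (1 + t))))) *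
          (Real.exp (-(2 * c * L)) * Real.exp (c * L)) := by ring
      _ ≤ _ := by
          rw [hcancel]
          gcongr
          exact gaussian_le_couplingProfile ht

theorem exp_mul_rpow_mul_Bprof_le (hα : 0 < α) (hk : 0 < k) {q K' : ℝ} (hq0 : 0 ≤ q)
    (hD₂ : 0 < D₂) (ha : 0 < a) (hc : 0 < c) (hK1 : 1 ≤ K) (hK'1 : 1 ≤ K')
    (hm : 1 ≤ m) (hml : lam ≤ m) (hlam : 0 < lam) (hs : 0 ≤ s) (hst : s ≤ t) (hr : 0 ≤ r)
    (hd : |r - ρ| ≤ d) (hLd : L = d + (t - s)) (hρ : ρ ≤ lam * s)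
    (h1 : 3 * m ^ 2 ≤ 2 * D₂ * a * (1 - q)) (h2 : 6 ≤ D₂ * a * (1 - q))
    (hK : (1 + L) ^ α ≤ K * Real.exp (c * L))
    (hK' : (1 + L) ^ (α + 2 * k) ≤ K' * Real.exp (c * L)) :
    Real.exp (-((a + 2 * c) * L)) * (1 + s) ^ (-α) * Bprof k s (ρ - lam * s) ≤
      (K + (2 * m ^ 2) ^ k * K') * couplingProfile α lam k D₂ t r * Real.exp (-(c * L)) := by
  have ht : 0 ≤ t := hs.trans hst
  have hd0 : 0 ≤ d := (abs_nonneg _).trans hd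
  have hL : t - s ≤ L := by linarith
  have hL0 : 0 ≤ L := by linarith
  have hP := couplingProfile_nonneg (α := α) (lam := lam) (k := k) (D₂ := D₂) (r := r) ht
  by_cases hz : r ≤ lam * t
  · have hzw : |(r - lam * t) - (ρ - lam * s)| ≤ m * L := by
      have e : (r - lam * t) - (ρ - lam * s) = (r - ρ) - lam * (t - s) := by ring
      rw [e]
      refine (abs_sub _ _).trans ?_
      rw [abs_of_nonneg (by nlinarith : 0 ≤ lam * (t - s))]
      nlinarith
    have hB := Bprof_le_Bprof_mul hk hm hs hst hL0 hzw
    have hB0 := Bprof_nonneg_s14 (k := k) (w := r - lam * t) ht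
    have hcancel : Real.exp (-(2 * c * L)) * Real.exp (c * L) = Real.exp (-(c * L)) := by
      rw [← Real.exp_add]; ring_nf
    calc _ ≤ Real.exp (-(2 * c * L)) * ((1 + t) ^ (-α) * (1 + L) ^ α) *
          ((2 * m ^ 2) ^ k * (Bprof k t (r - lam * t) * (1 + L) ^ (2 * k))) := by
          have := Bprof_nonneg_s14 (k := k) (w := ρ - lam * s) hs
          gcongr
          · linarith
          · exact one_add_rpow_neg_le hα hs hst hL
      _ = (2 * m ^ 2) ^ k * ((1 + t) ^ (-α) * Bprof k t (r - lam * t)) *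
          (Real.exp (-(2 * c * L)) * (1 + L) ^ (α + 2 * k)) := by
          rw [Real.rpow_add (by linarith)]; ring
      _ ≤ (2 * m ^ 2) ^ k * couplingProfile α lam k D₂ t r *
          (Real.exp (-(2 * c * L)) * (K' * Real.exp (c * L))) := by
          gcongr
          exact Bprof_le_couplingProfile ht hz
      _ = ((2 * m ^ 2) ^ k * K') * couplingProfile α lam k D₂ t r *
          (Real.exp (-(2 * c * L)) * Real.exp (c * L)) := by ring
      _ ≤ _ := by
          rw [hcancel]
          gcongr
          linarith
  · push Not at hz
    have hzL : r - lam * t ≤ L := by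
      have := le_abs_self (r - ρ)
      nlinarith
    have hqz : (1 - q) * (r - lam * t) ≤ L := by nlinarith
    have key := gaussian_or_exp_exponent_le (L := L) ha hD₂ hm hml hr ht h1 h2
      (by rw [abs_of_pos (by linarith)]; nlinarith) (fun _ => hqz)
    calc _ ≤ Real.exp (-((a + 2 * c) * L)) * (1 + s) ^ (-α) :=
          mul_le_of_le_one_right (by positivity) (Bprof_le_one_s14 hk.le hs)
      _ ≤ K * couplingProfile α lam k D₂ t r * Real.exp (-(c * L)) :=
          exp_mul_rpow_le_of_gaussian_or_exp hα hK1 hc hs hst hL hK key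
      _ ≤ _ := by
          gcongr
          exact le_add_of_nonneg_right (by positivity)

end Pointwise

theorem lintegral_lintegral_exp_le {c A₁ A₂ T t : ℝ} (hA₁ : 0 ≤ A₁) (hT : 0 ≤ T) (x : E3)
    (h₁ : ∫⁻ y : E3, ENNReal.ofReal (Real.exp (-(c * ‖x - y‖))) = ENNReal.ofReal A₁)
    (h₂ : ∫⁻ s : ℝ, ENNReal.ofReal (Real.exp (-(c * ‖t - s‖))) = ENNReal.ofReal A₂) :
    ∫⁻ s in Set.Icc (0 : ℝ) t, ∫⁻ y : E3,
        ENNReal.ofReal (T * Real.exp (-(c * (‖x - y‖ + (t - s))))) ≤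
      ENNReal.ofReal (T * A₁ * A₂) := by
  calc _ = ∫⁻ s in Set.Icc (0 : ℝ) t, ENNReal.ofReal (T * A₁) *
        ENNReal.ofReal (Real.exp (-(c * ‖t - s‖))) := by
        refine setLIntegral_congr_fun measurableSet_Icc fun s hs => ?_
        have hn : ‖t - s‖ = t - s := by
          rw [Real.norm_eq_abs, abs_of_nonneg (by linarith [hs.2])]
        have he : ∀ y : E3, ENNReal.ofReal (T * Real.exp (-(c * (‖x - y‖ + (t - s))))) =
            ENNReal.ofReal (T * Real.exp (-(c * (t - s)))) *
              ENNReal.ofReal (Real.exp (-(c * ‖x - y‖))) := fun y => by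
          rw [← ENNReal.ofReal_mul (by positivity), mul_assoc, ← Real.exp_add]
          ring_nf
        simp only [he, hn]
        rw [lintegral_const_mul' _ _ ENNReal.ofReal_ne_top, h₁,
          ← ENNReal.ofReal_mul (by positivity), ← ENNReal.ofReal_mul (by positivity)]
        ring_nf
    _ ≤ ∫⁻ s : ℝ, ENNReal.ofReal (T * A₁) * ENNReal.ofReal (Real.exp (-(c * ‖t - s‖))) :=
        setLIntegral_le_lintegral _ _
    _ = _ := by
        rw [lintegral_const_mul' _ _ ENNReal.ofReal_ne_top, h₂,
          ← ENNReal.ofReal_mul (by positivity)]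

/-- Coupling of the exponentially localized wave with Huygens-type waves: for
`α, D, λ > 0`, `k > 3/2`, `0 < η < 2/3` and
`D₂ > max{3D max{1,λ}²/(2-2√(3η/2)), 6D/(1-√(3η/2))}`, there is `C > 0` such that
both `M = ∫₀ᵗ ∫ e^{-(|x-y|+(t-s))/D} (1+s)^{-α} e^{-(|y|-λs)²/(ηD₂(1+s))} dy ds` and
`N = ∫₀ᵗ ∫_{|y|≤λs} e^{-(|x-y|+(t-s))/D} (1+s)^{-α} B_k(s,|y|-λs) dy ds` are bounded by
`C (1+t)^{-α}(e^{-3(|x|-λt)²/(2D₂(1+t))} + e^{-3|x|²/(2D₂(1+t))}) + C e^{-3(|x|+t)/(2D₂)}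
  + C (1+t)^{-α} B_k(t,|x|-λt) 1_{|x|≤λt}`. -/
theorem singular_huygens_coupling (α D lam k η D₂ : ℝ) (hα : 0 < α) (hD : 0 < D)
    (hlam : 0 < lam) (hk : 3 / 2 < k) (hη0 : 0 < η) (hη : η < 2 / 3)
    (hD₂ : max (3 * D / (2 - 2 * Real.sqrt (3 * η / 2)) * max 1 lam ^ 2)
        (6 * D / (1 - Real.sqrt (3 * η / 2))) < D₂) :
    ∃ C > (0 : ℝ), ∀ t : ℝ, 0 ≤ t → ∀ x : E3,
      (∫⁻ s in Set.Icc (0 : ℝ) t, ∫⁻ y : E3,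
          ENNReal.ofReal (Real.exp (-(‖x - y‖ + (t - s)) / D) * (1 + s) ^ (-α) *
            Real.exp (-(‖y‖ - lam * s) ^ 2 / (η * D₂ * (1 + s))))) ≤
        ENNReal.ofReal (C * (1 + t) ^ (-α) *
            (Real.exp (-3 * (‖x‖ - lam * t) ^ 2 / (2 * D₂ * (1 + t))) +
              Real.exp (-3 * ‖x‖ ^ 2 / (2 * D₂ * (1 + t)))) +
          C * Real.exp (-3 * (‖x‖ + t) / (2 * D₂)) +
          C * (1 + t) ^ (-α) *
            (if ‖x‖ ≤ lam * t then Bprof k t (‖x‖ - lam * t) else 0)) ∧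
      (∫⁻ s in Set.Icc (0 : ℝ) t, ∫⁻ y in {y : E3 | ‖y‖ ≤ lam * s},
          ENNReal.ofReal (Real.exp (-(‖x - y‖ + (t - s)) / D) * (1 + s) ^ (-α) *
            Bprof k s (‖y‖ - lam * s))) ≤
        ENNReal.ofReal (C * (1 + t) ^ (-α) *
            (Real.exp (-3 * (‖x‖ - lam * t) ^ 2 / (2 * D₂ * (1 + t))) +
              Real.exp (-3 * ‖x‖ ^ 2 / (2 * D₂ * (1 + t)))) +
          C * Real.exp (-3 * (‖x‖ + t) / (2 * D₂)) +
          C * (1 + t) ^ (-α) *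
            (if ‖x‖ ≤ lam * t then Bprof k t (‖x‖ - lam * t) else 0)) := by
  set q := Real.sqrt (3 * η / 2) with hq
  have hq0 : 0 ≤ q := Real.sqrt_nonneg _
  have hq1 : q < 1 := by
    rw [hq, Real.sqrt_lt' one_pos]; linarith
  have hq1' : 0 < 1 - q := by linarith
  obtain ⟨hD1, hD2⟩ := max_lt_iff.1 hD₂
  set m := max 1 lam
  have hm : 1 ≤ m := le_max_left _ _
  have hml : lam ≤ m := le_max_right _ _
  have hD₂0 : 0 < D₂ := lt_trans (by positivity) hD2
  have hk0 : 0 < k := by linarith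
  obtain ⟨a, ha1, ha2⟩ : ∃ a, max (3 * m ^ 2 / (2 * D₂ * (1 - q))) (6 / (D₂ * (1 - q))) < a ∧
      a < 1 / D := by
    refine exists_between (max_lt ?_ ?_)
    · rw [div_lt_div_iff₀ (by positivity) hD]
      have e : 3 * D / (2 - 2 * q) * m ^ 2 = 3 * D * m ^ 2 / (2 * (1 - q)) := by ring
      rw [e, div_lt_iff₀ (by positivity)] at hD1
      linarith
    · rw [div_lt_div_iff₀ (by positivity) hD]
      rw [div_lt_iff₀ hq1'] at hD2
      linarith
  obtain ⟨ha1, ha3⟩ := max_lt_iff.1 ha1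
  have ha : 0 < a := lt_trans (by positivity) ha1
  have h1 : 3 * m ^ 2 ≤ 2 * D₂ * a * (1 - q) := by
    rw [div_lt_iff₀ (by positivity)] at ha1
    linarith
  have h2 : 6 ≤ D₂ * a * (1 - q) := by
    rw [div_lt_iff₀ (by positivity)] at ha3
    linarith
  obtain ⟨c, hc, hac⟩ : ∃ c, 0 < c ∧ a + 2 * c = 1 / D :=
    ⟨(1 / D - a) / 2, by linarith, by ring⟩
  obtain ⟨K, hK1, hK⟩ := one_add_rpow_le_mul_exp_s14 hα hc
  obtain ⟨K', hK'1, hK'⟩ := one_add_rpow_le_mul_exp_s14 (by positivity : 0 < α + 2 * k) hc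
  obtain ⟨A₁, hA₁, hI₁⟩ := lintegral_exp_neg_mul_norm_sub (volume : Measure E3) hc
  obtain ⟨A₂, hA₂, hI₂⟩ := lintegral_exp_neg_mul_norm_sub (volume : Measure ℝ) hc
  set K₀ := K + (2 * m ^ 2) ^ k * K'
  have hKK₀ : K ≤ K₀ := le_add_of_nonneg_right (by positivity)
  have hK₀ : 0 < K₀ := by linarith
  refine ⟨K₀ * (A₁ * A₂) + 1, by positivity, fun t ht x => ?_⟩
  have hP := couplingProfile_nonneg (α := α) (lam := lam) (k := k) (D₂ := D₂) (r := ‖x‖) ht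
  have hmain : ∫⁻ s in Set.Icc (0 : ℝ) t, ∫⁻ y : E3,
      ENNReal.ofReal (K₀ * couplingProfile α lam k D₂ t ‖x‖ *
        Real.exp (-(c * (‖x - y‖ + (t - s))))) ≤
      ENNReal.ofReal ((K₀ * (A₁ * A₂) + 1) * couplingProfile α lam k D₂ t ‖x‖) := by
    refine (lintegral_lintegral_exp_le hA₁ (by positivity) x (hI₁ x) (hI₂ t)).trans
      (ENNReal.ofReal_le_ofReal ?_)
    linarith
  have hexp : ∀ u : ℝ, -u / D = -((a + 2 * c) * u) := fun u => by rw [hac]; ring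
  have hrhs : ∀ C g e b : ℝ, C * (1 + t) ^ (-α) * g + C * e + C * (1 + t) ^ (-α) * b =
      C * ((1 + t) ^ (-α) * g + e + (1 + t) ^ (-α) * b) := fun C g e b => by ring
  rw [hrhs]
  refine ⟨le_trans ?_ hmain, le_trans ?_ hmain⟩
  · refine setLIntegral_mono' measurableSet_Icc fun s hs => lintegral_mono fun y =>
      ENNReal.ofReal_le_ofReal ?_
    rw [hexp]
    have hL0 : 0 ≤ ‖x - y‖ + (t - s) := add_nonneg (norm_nonneg _) (by linarith [hs.2])
    refine (exp_mul_rpow_mul_gaussian_le (k := k) hα hη0 hη hD₂0 ha hc hK1 hm hml hlam hs.1 hs.2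
      (norm_nonneg x) (abs_norm_sub_norm_le x y) rfl h1 h2 (hK _ hL0)).trans ?_
    gcongr
  · refine setLIntegral_mono' measurableSet_Icc fun s hs =>
      (setLIntegral_mono' (measurableSet_le measurable_norm measurable_const) fun y hy =>
        ENNReal.ofReal_le_ofReal ?_).trans (setLIntegral_le_lintegral _ _)
    rw [hexp]
    have hL0 : 0 ≤ ‖x - y‖ + (t - s) := add_nonneg (norm_nonneg _) (by linarith [hs.2])
    exact exp_mul_rpow_mul_Bprof_le hα hk0 hq0 hD₂0 ha hc hK1 hK'1 hm hml hlam hs.1 hs.2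
      (norm_nonneg x) (abs_norm_sub_norm_le x y) rfl hy h1 h2 (hK _ hL0) (hK' _ hL0)

end
end
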